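/- Let λ be a partition of r of length n, let 0 ≤ j ≤ min{n, r−n−1}, set d = r + n − j, and let D_j(λ) be the set of partitions λ' = [λ_1 − ι_1, …, λ_n − ι_n] with ι_i ∈ {0,1} and Σι_i = j. Then, set-theoretically, the closure of the preimage under the apolar map Ψ_{d,r} of the j-th higher associated variety CH_j(Δ_λ) ⊂ 𝔾(r−n−1+j, r) equals the union over λ' ∈ D_j(λ) of the closures of the preimages under Ψ_{d,r−j} of Ξ_0^{r−j−n−1}(Δ_{λ'}) ⊂ 𝔾(r−j−n−1, r−j). -/

import Mathlib

open MvPolynomial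

noncomputable section

/-- The Zariski closure of a subset of the affine space `σ → K`. -/
def zClosure {K : Type} [Field K] {σ : Type} [Fintype σ] [DecidableEq σ]
    (S : Set (σ → K)) : Set (σ → K) :=
  {x | ∀ p : MvPolynomial σ K, (∀ y ∈ S, eval y p = 0) → eval x p = 0}

/-- A subset of affine space is Zariski closed if it equals its Zariski closure. -/
def zClosed {K : Type} [Field K] {σ : Type} [Fintype σ] [DecidableEq σ]
    (S : Set (σ → K)) : Prop :=
  zClosure S = S

/-- Irreducibility of a subset of affine space in the Zariski topology,
tested against the basic open sets. -/
def zIrreducible {K : Type} [Field K] {σ : Type} [Fintype σ] [DecidableEq σ]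
    (S : Set (σ → K)) : Prop :=
  S.Nonempty ∧ ∀ p q : MvPolynomial σ K,
    (∀ x ∈ S, eval x p = 0 ∨ eval x q = 0) →
    (∀ x ∈ S, eval x p = 0) ∨ (∀ x ∈ S, eval x q = 0)

/-- There is a strictly increasing chain of `m+1` irreducible Zariski-closed
subsets contained in `S`. -/
def zChain {K : Type} [Field K] {σ : Type} [Fintype σ] [DecidableEq σ]
    (S : Set (σ → K)) (m : ℕ) : Prop :=
  ∃ c : Fin (m+1) → Set (σ → K),
    (∀ i, zIrreducible (c i) ∧ zClosed (c i) ∧ c i ⊆ S) ∧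
    ∀ i j : Fin (m+1), i < j → c i ⊂ c j

/-- `S` has (Krull) dimension `m` in the Zariski topology. -/
def zDimEq {K : Type} [Field K] {σ : Type} [Fintype σ] [DecidableEq σ]
    (S : Set (σ → K)) (m : ℕ) : Prop :=
  zChain S m ∧ ¬ zChain S (m+1)

/-- The (embedded, affine) Zariski tangent space to `S` at `a`: the common kernel of the
differentials at `a` of all polynomials vanishing on `S`. -/
def zTangentAt {K : Type} [Field K] {σ : Type} [Fintype σ] [DecidableEq σ]
    (S : Set (σ → K)) (a : σ → K) : Set (σ → K) :=
  {v | ∀ p : MvPolynomial σ K, (∀ y ∈ S, eval y p = 0) →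
        ∑ i : σ, eval a (pderiv i p) * v i = 0}

/-- Dimension of the Zariski tangent space at a point. -/
def zTangentDim {K : Type} [Field K] {σ : Type} [Fintype σ] [DecidableEq σ]
    (S : Set (σ → K)) (a : σ → K) : ℕ :=
  Module.finrank K (Submodule.span K (zTangentAt S a))

/-- The binary form of degree `r` with coefficient vector `a`. -/
def binForm {K : Type} [CommSemiring K] (r : ℕ) (a : Fin (r+1) → K) :
    MvPolynomial (Fin 2) K :=
  ∑ i : Fin (r+1), C (a i) * X 0 ^ (r - (i : ℕ)) * X 1 ^ (i : ℕ)

/-- The linear binary form `u·x + v·y`. -/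
def linForm {K : Type} [CommSemiring K] (u v : K) : MvPolynomial (Fin 2) K :=
  C u * X 0 + C v * X 1

/-- The affine cone over the coincident root locus `Δ_λ ⊆ ℙ^r`, in coefficient coordinates:
scalar multiples of forms `∏ ℓ_i ^ λ_i`. -/
def crlCone (r n : ℕ) (lam : Fin n → ℕ) : Set (Fin (r+1) → ℂ) :=
  {a | ∃ (t : ℂ) (u v : Fin n → ℂ),
    binForm r a = C t * ∏ i, (linForm (u i) (v i)) ^ lam i}

/-- `lam` is a partition of `r` of length `n` (all parts positive). -/
def isPartitionOf (r n : ℕ) (lam : Fin n → ℕ) : Prop :=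
  (∀ i, 1 ≤ lam i) ∧ ∑ i, lam i = r

/-- The multiplicity `m_j` of the part `j` in the partition `lam`. -/
def multOf {n : ℕ} (lam : Fin n → ℕ) (jj : ℕ) : ℕ :=
  (Finset.univ.filter fun i => lam i = jj).card

/-- The differential operator of degree `s` with coefficient vector `b`, i.e.
`∑ b_i ∂x^(s-i) ∂y^i`, applied to `f`. -/
def diffOp {K : Type} [CommSemiring K] (s : ℕ) (b : Fin (s+1) → K)
    (f : MvPolynomial (Fin 2) K) : MvPolynomial (Fin 2) K :=
  ∑ i : Fin (s+1), b i •
    ((fun g => pderiv (0 : Fin 2) g)^[s - (i : ℕ)]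
      (((fun g => pderiv (1 : Fin 2) g)^[(i : ℕ)]) f))

/-- The apolarity pairing between a degree-`d` operator (coefficients `h`) and a
degree-`d` form (coefficients `a`). -/
def apolarPair (d : ℕ) (h a : Fin (d+1) → ℂ) : ℂ :=
  eval (fun _ => (0 : ℂ)) (diffOp d h (binForm d a))

/-- The cone over the dual variety of the cone `S ⊆ ℂ^(m+1)` (with `k` the dimension of the
cone `S`, used to select smooth points): closure of the set of hyperplanes, written in dual
coordinates via the apolarity pairing, containing an embedded tangent space at a smooth point. -/
def dualConeOf (m : ℕ) (S : Set (Fin (m+1) → ℂ)) (k : ℕ) : Set (Fin (m+1) → ℂ) :=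
  zClosure {h | h ≠ 0 ∧ ∃ a ∈ S, a ≠ 0 ∧ zTangentDim S a = k ∧
      ∀ v ∈ zTangentAt S a, apolarPair m h v = 0}

/-- The row span of a matrix, as a subspace of `ℂ^m`. -/
def rowSpan {k m : ℕ} (M : Matrix (Fin k) (Fin m) ℂ) : Submodule ℂ (Fin m → ℂ) :=
  Submodule.span ℂ (Set.range fun i => M i)

/-- The (redundant) Plücker coordinate vector of the row span of `M`: all maximal minors. -/
def plucker {k m : ℕ} (M : Matrix (Fin k) (Fin m) ℂ) : (Fin k → Fin m) → ℂ :=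
  fun s => (M.submatrix id s).det

/-- The degree-`s` component of the apolar ideal of the degree-`d` form with
coefficients `a`, as a subset of the coefficient space of operators. -/
def apolarSet (d s : ℕ) (a : Fin (d+1) → ℂ) : Set (Fin (s+1) → ℂ) :=
  {b | diffOp s b (binForm d a) = 0}

/-- The (pre-closure) cone, in Plücker coordinates, over the `j`-th higher associated variety
`CH_j(S)`: spans of `k`-row matrices whose row space contains a smooth point `x` of the cone
`S` (`dimS` = dimension of the cone `S`) and meets the tangent space at `x` in projective
dimension at least `j`. -/
def smoothCHCone (m : ℕ) (S : Set (Fin (m+1) → ℂ)) (dimS k j : ℕ) :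
    Set ((Fin k → Fin (m+1)) → ℂ) :=
  {u | ∃ M : Matrix (Fin k) (Fin (m+1)) ℂ, u = plucker M ∧
    Module.finrank ℂ (rowSpan M) = k ∧
    ∃ x, x ≠ 0 ∧ x ∈ S ∧ zTangentDim S x = dimS ∧ x ∈ rowSpan M ∧
      j + 1 ≤ Module.finrank ℂ ↥(rowSpan M ⊓ Submodule.span ℂ (zTangentAt S x))}

/-- The (pre-closure) cone, in Plücker coordinates, over `Ξ_0(S)`: spans of `k`-row matrices
whose row space meets the cone `S` nontrivially. -/
def meetCone (m : ℕ) (S : Set (Fin (m+1) → ℂ)) (k : ℕ) :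
    Set ((Fin k → Fin (m+1)) → ℂ) :=
  {u | ∃ M : Matrix (Fin k) (Fin (m+1)) ℂ, u = plucker M ∧
    Module.finrank ℂ (rowSpan M) = k ∧ ∃ x, x ≠ 0 ∧ x ∈ S ∧ x ∈ rowSpan M}

/-- The preimage under the apolar map `Ψ_{d,s}` of a subset `T` of the Grassmannian
(in Plücker coordinates) of `(k-1)`-projective-dimensional subspaces of `ℙ(D_s)`. -/
def apolarPull (d s k : ℕ) (T : Set ((Fin k → Fin (s+1)) → ℂ)) : Set (Fin (d+1) → ℂ) :=
  {a | ∃ M : Matrix (Fin k) (Fin (s+1)) ℂ,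
    rowSpan M = Submodule.span ℂ (apolarSet d s a) ∧
    Module.finrank ℂ (rowSpan M) = k ∧ plucker M ∈ T}

/-- The Waring rank over `K` of a binary form: the least `r` such that `f` is a sum of `r`
scalar multiples of `d`-th powers of linear forms. -/
def waringRank {K : Type} [Field K] (d : ℕ) (f : MvPolynomial (Fin 2) K) : ℕ :=
  sInf {r | ∃ (α u v : Fin r → K), f = ∑ i, α i • (linForm (u i) (v i)) ^ d}

/-- The set of coefficient vectors of real binary forms of degree `d` of real rank `r`. -/
def realRankSet (d r : ℕ) : Set (Fin (d+1) → ℝ) :=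
  {a | waringRank d (binForm d a) = r}

/-- `R_{d,r}`: the interior, in the Euclidean topology, of the set of real binary forms of
degree `d` and real rank `r`. -/
def Rdr (d r : ℕ) : Set (Fin (d+1) → ℝ) := interior (realRankSet d r)

/-- The topological boundary of `R_{d,r}`: the closure of `R_{d,r}` minus the interior of
the closure. -/
def topBoundary (d r : ℕ) : Set (Fin (d+1) → ℝ) :=
  closure (Rdr d r) \ interior (closure (Rdr d r))

/-- The algebraic boundary `∂_alg(R_{d,r})`: the Zariski closure over `ℂ` of the topological
boundary of `R_{d,r}`. -/
def algBoundary (d r : ℕ) : Set (Fin (d+1) → ℂ) :=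
  zClosure ((fun a i => ((a i : ℝ) : ℂ)) '' topBoundary d r)


/-- homogeneous components of a polynomial vanishing on a cone vanish on the cone -/
theorem pcd_homog_comp_vanish {τ : Type} (q : MvPolynomial τ ℂ) (v : τ → ℂ)
    (h : ∀ c : ℂ, eval (c • v) q = 0) (N : ℕ) : eval v (homogeneousComponent N q) = 0 := by
  classical
  have key : ∀ c : ℂ, eval (c • v) q
      = ∑ i ∈ Finset.range (q.totalDegree + 1), c ^ i * eval v (homogeneousComponent i q) := by
    intro c
    conv_lhs => rw [← sum_homogeneousComponent q]
    rw [map_sum]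
    refine Finset.sum_congr rfl fun i _ => ?_
    have hh := homogeneousComponent_isHomogeneous i q
    rw [eval_eq, eval_eq, Finset.mul_sum]
    refine Finset.sum_congr rfl fun d hd => ?_
    have hdeg : d.degree = i := by
      by_contra hne
      exact (mem_support_iff.mp hd) (hh.coeff_eq_zero hne)
    simp only [Pi.smul_apply, smul_eq_mul, mul_pow, Finset.prod_mul_distrib, Finset.prod_pow_eq_pow_sum]
    have : ∑ x ∈ d.support, d x = i := by rw [← hdeg]; rfl
    rw [this]; ring
  by_cases hN : N ≤ q.totalDegree
  · set P : Polynomial ℂ := ∑ i ∈ Finset.range (q.totalDegree + 1),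
      Polynomial.C (eval v (homogeneousComponent i q)) * Polynomial.X ^ i with hP
    have hP0 : P = 0 := by
      apply Polynomial.funext
      intro c
      have := key c
      rw [h c] at this
      rw [hP, Polynomial.eval_finsetSum]
      simp only [Polynomial.eval_mul, Polynomial.eval_C, Polynomial.eval_pow, Polynomial.eval_X,
        Polynomial.eval_zero]
      rw [this]
      exact Finset.sum_congr rfl fun i _ => mul_comm _ _
    have := congrArg (fun p => Polynomial.coeff p N) hP0
    simp only [hP, Polynomial.finsetSum_coeff, Polynomial.coeff_C_mul_X_pow, Polynomial.coeff_zero] at this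
    rw [Finset.sum_ite_eq, if_pos (Finset.mem_range.mpr (by omega))] at this
    exact this
  · rw [homogeneousComponent_eq_zero _ _ (by omega)]; simp

theorem pcd_map_homogComp {σ τ : Type} (f : MvPolynomial σ ℂ →+* ℂ)
    (p : MvPolynomial τ (MvPolynomial σ ℂ)) (N : ℕ) :
    map f (homogeneousComponent N p) = homogeneousComponent N (map f p) := by
  classical
  ext d
  rw [coeff_map, coeff_homogeneousComponent, coeff_homogeneousComponent, coeff_map]
  split_ifs <;> simp

/-- Main theorem of elimination theory, in conical form. -/
theorem pcd_elim {σ τ : Type} [Fintype τ]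
    (Z : Set ((σ → ℂ) × (τ → ℂ)))
    (hcl : ∀ w : (σ → ℂ) × (τ → ℂ), (∀ p : MvPolynomial τ (MvPolynomial σ ℂ),
      (∀ z ∈ Z, eval z.2 (map (eval z.1) p) = 0) → eval w.2 (map (eval w.1) p) = 0) → w ∈ Z)
    (hcone : ∀ y v (c : ℂ), (y, v) ∈ Z → (y, c • v) ∈ Z)
    (y0 : σ → ℂ)
    (h : ∀ a : MvPolynomial σ ℂ, (∀ y, (∃ v, v ≠ 0 ∧ (y, v) ∈ Z) → eval y a = 0) → eval y0 a = 0) :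
    ∃ v, v ≠ 0 ∧ (y0, v) ∈ Z := by
  classical
  by_contra hcon
  push Not at hcon
  rcases isEmpty_or_nonempty τ with hE | hE
  · have := h 1 (fun y ⟨v, hv, _⟩ => absurd (Subsingleton.elim v 0) hv)
    simp at this
  let I : Ideal (MvPolynomial τ (MvPolynomial σ ℂ)) :=
    { carrier := {p | ∀ z ∈ Z, eval z.2 (map (eval z.1) p) = 0}
      add_mem' := by
        intro a b ha hb z hz
        simp [ha z hz, hb z hz]
      zero_mem' := by intro z _; simp
      smul_mem' := by
        intro c a ha z hz
        simp [ha z hz] }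
  have hImem : ∀ p, p ∈ I ↔ ∀ z ∈ Z, eval z.2 (map (eval z.1) p) = 0 := fun p => Iff.rfl
  have hIhom : ∀ p ∈ I, ∀ N, homogeneousComponent N p ∈ I := by
    intro p hp N z hz
    rw [pcd_map_homogComp]
    apply pcd_homog_comp_vanish
    intro c
    exact hp (z.1, c • z.2) (hcone _ _ c hz)
  let Ev : MvPolynomial τ (MvPolynomial σ ℂ) →+* MvPolynomial τ ℂ := map (eval y0)
  have hEsurj : Function.Surjective Ev := map_surjective _ (fun c => ⟨C c, by simp⟩)
  have hnull : ∀ i : τ, ∃ N : ℕ, (X i : MvPolynomial τ ℂ) ^ N ∈ I.map Ev := by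
    intro i
    have : (X i : MvPolynomial τ ℂ) ∈ (I.map Ev).radical := by
      rw [← vanishingIdeal_zeroLocus_eq_radical (K := ℂ), mem_vanishingIdeal_iff]
      intro v hv
      rw [mem_zeroLocus_iff] at hv
      by_cases hv0 : v = 0
      · simp [hv0]
      · exfalso
        apply hcon v hv0
        apply hcl
        intro p hp
        have := hv (Ev p) (Ideal.mem_map_of_mem _ hp)
        rwa [aeval_eq_eval] at this
    exact this
  choose Nf hNf using hnull
  set N := ∑ i, Nf i with hN
  have hN' : ∀ i, (X i : MvPolynomial τ ℂ) ^ N ∈ I.map Ev := by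
    intro i
    have hle : Nf i ≤ N := Finset.single_le_sum (f := Nf) (fun _ _ => Nat.zero_le _) (Finset.mem_univ i)
    rw [← Nat.sub_add_cancel hle, pow_add]
    exact Ideal.mul_mem_left _ _ (hNf i)
  have hp : ∀ i, ∃ p ∈ I, p.IsHomogeneous N ∧ Ev p = X i ^ N := by
    intro i
    obtain ⟨p, hpI, hpe⟩ := (Ideal.mem_map_iff_of_surjective _ hEsurj).mp (hN' i)
    refine ⟨homogeneousComponent N p, hIhom p hpI N, homogeneousComponent_isHomogeneous _ _, ?_⟩
    change map (eval y0) _ = _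
    rw [pcd_map_homogComp]
    change homogeneousComponent N (Ev p) = _
    rw [hpe]
    exact homogeneousComponent_eq_self (isHomogeneous_X_pow i N)
  choose P hPI hPh hPe using hp
  set D := Fintype.card τ * N with hD
  let W := homogeneousSubmodule τ (MvPolynomial σ ℂ) D
  let mk : MvPolynomial τ (MvPolynomial σ ℂ) →ₗ[MvPolynomial σ ℂ] (MvPolynomial τ (MvPolynomial σ ℂ)) ⧸ I :=
    (Ideal.Quotient.mkₐ (MvPolynomial σ ℂ) I).toLinearMap
  have hmk : ∀ p, p ∈ I → mk p = 0 := fun p hp => Ideal.Quotient.eq_zero_iff_mem.mpr hp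
  have hmk' : ∀ p, mk p = 0 → p ∈ I := fun p hp => Ideal.Quotient.eq_zero_iff_mem.mp hp
  let m : Ideal (MvPolynomial σ ℂ) := RingHom.ker (eval y0)
  have hker : ∀ q ∈ W, Ev q = 0 → q ∈ m • W := by
    intro q hq hq0
    rw [q.as_sum]
    refine Submodule.sum_mem _ fun d hd => ?_
    have e : monomial d (coeff d q) = coeff d q • monomial d (1 : MvPolynomial σ ℂ) := by
      rw [smul_monomial]; simp
    rw [e]
    refine Submodule.smul_mem_smul ?_ ?_
    · change eval y0 (coeff d q) = 0
      have := congrArg (coeff d) hq0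
      simpa [Ev, coeff_map] using this
    · apply isHomogeneous_monomial
      by_contra hne
      exact (mem_support_iff.mp hd) (IsHomogeneous.coeff_eq_zero hq hne)
  have hle : W.map mk ≤ m • W.map mk := by
    rw [Submodule.map_le_iff_le_comap]
    intro q hq
    rw [Submodule.mem_comap, ← Submodule.map_smul'', q.as_sum, map_sum]
    refine Submodule.sum_mem _ fun d hd => ?_
    have e : monomial d (coeff d q) = coeff d q • monomial d (1 : MvPolynomial σ ℂ) := by
      rw [smul_monomial]; simp
    rw [e, map_smul]
    refine Submodule.smul_mem _ _ ?_
    have hdeg : d.degree = D := by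
      by_contra hne
      exact (mem_support_iff.mp hd) (IsHomogeneous.coeff_eq_zero hq hne)
    obtain ⟨i, hi⟩ : ∃ i, N ≤ d i := by
      by_contra hcon
      push Not at hcon
      have h1 : d.degree = ∑ i, d i := Finsupp.degree_eq_sum d
      have h2 : ∑ i, d i < ∑ _i : τ, N :=
        Finset.sum_lt_sum_of_nonempty Finset.univ_nonempty fun i _ => hcon i
      simp only [Finset.sum_const, Finset.card_univ, smul_eq_mul] at h2
      omega
    set d' := d - Finsupp.single i N with hd'
    have hdd : d' + Finsupp.single i N = d := by
      ext k
      by_cases hk : k = i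
      · subst hk; simp [hd', hi]
      · simp [hd', Ne.symm hk]
    have hdeg' : d'.degree + N = D := by
      rw [← hdeg, ← hdd, map_add]; simp
    have hhom : (monomial d' (1 : MvPolynomial σ ℂ) * P i).IsHomogeneous D := by
      rw [← hdeg']
      exact (isHomogeneous_monomial _ rfl).mul (hPh i)
    refine ⟨monomial d 1 - monomial d' 1 * P i, hker _ ?_ ?_, ?_⟩
    · exact (isHomogeneous_monomial _ hdeg).sub hhom
    · rw [map_sub, map_mul, hPe]
      simp only [Ev, map_monomial, map_one]
      rw [X_pow_eq_monomial, monomial_mul, hdd]; simp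
    · rw [map_sub, hmk _ (I.mul_mem_left _ (hPI i)), sub_zero]
  obtain ⟨a, ha1, ha2⟩ := Submodule.exists_sub_one_mem_and_smul_eq_zero_of_fg_of_le_smul m (W.map mk)
    ((homogeneousSubmodule_fg _ _ D).map mk) hle
  have ha1' : eval y0 a = 1 := by
    have : eval y0 (a - 1) = 0 := ha1
    rw [map_sub, map_one] at this
    exact sub_eq_zero.mp this
  have : eval y0 a = 0 := by
    apply h
    rintro y ⟨v, hv, hz⟩
    obtain ⟨i, hi⟩ := Function.ne_iff.mp hv
    have h1 : a • (X i : MvPolynomial τ (MvPolynomial σ ℂ)) ^ D ∈ I := by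
      apply hmk'
      rw [map_smul]
      exact ha2 _ ⟨_, isHomogeneous_X_pow i D, rfl⟩
    have h2 := h1 _ hz
    rw [smul_eq_C_mul] at h2
    simp only [map_mul, map_C, eval_C, map_pow, map_X, eval_X, mul_eq_zero] at h2
    rcases h2 with h2 | h2
    · exact h2
    · exact absurd h2 (pow_ne_zero D hi)
  rw [ha1'] at this
  exact one_ne_zero this


/-- Zariski closedness, without instance arguments. -/
def pcdZC {ρ : Type} (Z : Set (ρ → ℂ)) : Prop :=
  ∀ w, (∀ p : MvPolynomial ρ ℂ, (∀ z ∈ Z, eval z p = 0) → eval w p = 0) → w ∈ Z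

theorem pcdZC_eqs {ρ I : Type} (P : I → MvPolynomial ρ ℂ) : pcdZC {w | ∀ i, eval w (P i) = 0} := by
  intro w h i
  exact h (P i) fun z hz => hz i

theorem pcdZC_inter {ρ : Type} {Z W : Set (ρ → ℂ)} (hZ : pcdZC Z) (hW : pcdZC W) :
    pcdZC (Z ∩ W) := by
  intro w h
  exact ⟨hZ w fun p hp => h p fun z hz => hp z hz.1, hW w fun p hp => h p fun z hz => hp z hz.2⟩

theorem pcd_eval_comp {ρ τ : Type} (y : ρ → ℂ) (v : τ → ℂ)
    (g : ρ → MvPolynomial τ (MvPolynomial ρ ℂ)) (w : ρ → ℂ)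
    (hg : ∀ x, eval v (map (eval y) (g x)) = w x) (q : MvPolynomial ρ ℂ) :
    eval v (map (eval y) (eval₂Hom (C.comp C) g q)) = eval w q := by
  have : ((eval v).comp (map (eval y))).comp (eval₂Hom (C.comp C) g) = eval w := by
    apply MvPolynomial.ringHom_ext
    · intro r; simp
    · intro x; simp [hg]
  exact congrArg (fun F : MvPolynomial ρ ℂ →+* ℂ => F q) this

theorem pcd_elim_blk {ρ : Type} [Fintype ρ] (T : Set ρ) (Z : Set (ρ → ℂ)) (hZ : pcdZC Z)
    (hcone : ∀ w ∈ Z, ∀ (c : ℂ) (w' : ρ → ℂ), (∀ x, x ∉ T → w' x = w x) →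
      (∀ x ∈ T, w' x = c * w x) → w' ∈ Z) :
    pcdZC {w | ∃ w' ∈ Z, (∀ x, x ∉ T → w' x = w x) ∧ ∃ x ∈ T, w' x ≠ 0} := by
  classical
  intro y0 hy0
  let ovr : (ρ → ℂ) → (T → ℂ) → (ρ → ℂ) := fun y v x => if h : x ∈ T then v ⟨x, h⟩ else y x
  have key := pcd_elim (σ := ρ) (τ := T) {z | ovr z.1 z.2 ∈ Z} ?_ ?_ y0 ?_
  · obtain ⟨v, hv, hz⟩ := key
    refine ⟨ovr y0 v, hz, ?_, ?_⟩
    · intro x hx; simp [ovr, hx]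
    · obtain ⟨i, hi⟩ := Function.ne_iff.mp hv
      exact ⟨i, i.2, by simpa [ovr] using hi⟩
  · intro w hw
    apply hZ
    intro q hq
    let g : ρ → MvPolynomial T (MvPolynomial ρ ℂ) :=
      fun x => if h : x ∈ T then X ⟨x, h⟩ else C (X x)
    have hf : ∀ (y : ρ → ℂ) (v : T → ℂ) (q : MvPolynomial ρ ℂ),
        eval v (map (eval y) (eval₂Hom (C.comp C) g q)) = eval (ovr y v) q := by
      intro y v q
      refine pcd_eval_comp y v g (ovr y v) ?_ q
      intro x
      by_cases hx : x ∈ T <;> simp [g, ovr, hx]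
    rw [← hf]
    apply hw
    intro z hz
    rw [hf]
    exact hq _ hz
  · intro y v c h
    refine hcone _ h c _ ?_ ?_
    · intro x hx; simp [ovr, hx]
    · intro x hx; simp [ovr, hx]
  · intro a ha
    apply hy0
    rintro y ⟨w', hw', h1, ⟨x, hx, hx0⟩⟩
    apply ha
    refine ⟨fun t => w' t, Function.ne_iff.mpr ⟨⟨x, hx⟩, hx0⟩, ?_⟩
    have : ovr y (fun t => w' t) = w' := by
      ext x
      by_cases hx : x ∈ T
      · simp [ovr, hx]
      · simp [ovr, hx, h1 x hx]
    simpa [this] using hw'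

theorem pcd_elim_dep {ρ κ β : Type} [Fintype κ] (ψ : κ → β → MvPolynomial ρ ℂ) :
    pcdZC {w | ∃ c : κ → ℂ, c ≠ 0 ∧ ∀ b, ∑ a, c a * eval w (ψ a b) = 0} := by
  intro y0 hy0
  refine pcd_elim (σ := ρ) (τ := κ) {z | ∀ b, ∑ a, z.2 a * eval z.1 (ψ a b) = 0} ?_ ?_ y0 ?_
  · intro w hw b
    have := hw (∑ a, X a * C (ψ a b)) (by
      intro z hz
      simpa using hz b)
    simpa using this
  · intro y v c h b
    have := h b
    simp only [Pi.smul_apply, smul_eq_mul, mul_assoc, ← Finset.mul_sum] at this ⊢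
    rw [this, mul_zero]
  · intro a ha
    exact hy0 a ha

theorem pcd_elim_multi {ρ κ : Type} [Fintype ρ] (T : κ → Set ρ)
    (hdisj : ∀ i j, i ≠ j → ∀ x, x ∈ T i → x ∉ T j) (Z : Set (ρ → ℂ)) (hZ : pcdZC Z)
    (hcone : ∀ i, ∀ w ∈ Z, ∀ (c : ℂ) (w' : ρ → ℂ), (∀ x, x ∉ T i → w' x = w x) →
      (∀ x ∈ T i, w' x = c * w x) → w' ∈ Z) (K : Finset κ) :
    pcdZC {w | ∃ w' ∈ Z, (∀ x, (∀ i ∈ K, x ∉ T i) → w' x = w x) ∧ ∀ i ∈ K, ∃ x ∈ T i, w' x ≠ 0} := by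
  classical
  have hscale : ∀ (K : Finset κ) (i : κ), ∀ w ∈ {w : ρ → ℂ | ∃ w' ∈ Z, (∀ x, (∀ i ∈ K, x ∉ T i) → w' x = w x) ∧
      ∀ i ∈ K, ∃ x ∈ T i, w' x ≠ 0}, ∀ (c : ℂ) (w2 : ρ → ℂ), (∀ x, x ∉ T i → w2 x = w x) →
      (∀ x ∈ T i, w2 x = c * w x) → w2 ∈ {w | ∃ w' ∈ Z, (∀ x, (∀ i ∈ K, x ∉ T i) → w' x = w x) ∧
      ∀ i ∈ K, ∃ x ∈ T i, w' x ≠ 0} := by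
    rintro K i w ⟨w', hw', h1, h2⟩ c w2 e1 e2
    by_cases hi : i ∈ K
    · refine ⟨w', hw', ?_, h2⟩
      intro x hx
      rw [h1 x hx, e1 x (hx i hi)]
    · refine ⟨fun x => if x ∈ T i then c * w' x else w' x, hcone i w' hw' c _ ?_ ?_, ?_, ?_⟩
      · intro x hx; simp [hx]
      · intro x hx; simp [hx]
      · intro x hx
        by_cases hxi : x ∈ T i
        · simp [hxi, e2 x hxi, h1 x hx]
        · simp [hxi, e1 x hxi, h1 x hx]
      · intro k hk
        obtain ⟨x, hx, hx0⟩ := h2 k hk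
        refine ⟨x, hx, ?_⟩
        have : x ∉ T i := hdisj k i (by rintro rfl; exact hi hk) x hx
        simpa [this] using hx0
  induction K using Finset.induction_on with
  | empty =>
    have : {w | ∃ w' ∈ Z, (∀ x, (∀ i ∈ (∅ : Finset κ), x ∉ T i) → w' x = w x) ∧
        ∀ i ∈ (∅ : Finset κ), ∃ x ∈ T i, w' x ≠ 0} = Z := by
      ext w
      constructor
      · rintro ⟨w', hw', h1, -⟩
        have : w' = w := funext fun x => h1 x (by simp)
        rwa [← this]
      · intro hw
        exact ⟨w, hw, by simp, by simp⟩
    rw [this]; exact hZ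
  | insert i K hi ih =>
    have := pcd_elim_blk (T i) _ ih (hscale K i)
    convert this using 1
    ext w
    constructor
    · rintro ⟨w', hw', h1, h2⟩
      refine ⟨fun x => if x ∈ T i then w' x else w x, ⟨w', hw', ?_, ?_⟩, ?_, ?_⟩
      · intro x hx
        by_cases hxi : x ∈ T i
        · simp [hxi]
        · simp only [hxi, if_false]
          apply h1
          intro k hk
          rcases Finset.mem_insert.mp hk with rfl | hk
          · exact hxi
          · exact hx k hk
      · intro k hk
        exact h2 k (Finset.mem_insert_of_mem hk)
      · intro x hx; simp [hx]
      · obtain ⟨x, hx, hx0⟩ := h2 i (Finset.mem_insert_self _ _)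
        exact ⟨x, hx, by simpa [hx] using hx0⟩
    · rintro ⟨w1, ⟨w', hw', h1, h2⟩, h3, x0, hx0, hx0'⟩
      refine ⟨w', hw', ?_, ?_⟩
      · intro x hx
        rw [h1 x fun k hk => hx k (Finset.mem_insert_of_mem hk), h3 x (hx i (Finset.mem_insert_self _ _))]
      · intro k hk
        rcases Finset.mem_insert.mp hk with rfl | hk
        · refine ⟨x0, hx0, ?_⟩
          rw [h1]
          · exact hx0'
          · intro k' hk'
            exact hdisj k k' (by rintro rfl; exact hi hk') x0 hx0
        · exact h2 k hk

/-! Plücker charts -/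

theorem pcd_rowSpan_mul_le {k k' m : ℕ} (U : Matrix (Fin k') (Fin k) ℂ) (M : Matrix (Fin k) (Fin m) ℂ) :
    rowSpan (U * M) ≤ rowSpan M := by
  unfold rowSpan
  rw [Submodule.span_le]
  rintro _ ⟨i, rfl⟩
  have : (U * M) i = ∑ a, U i a • M a := by
    ext b
    simp [Matrix.mul_apply, Finset.sum_apply]
  simp only [SetLike.mem_coe]
  rw [this]
  exact Submodule.sum_mem _ fun a _ => Submodule.smul_mem _ _ (Submodule.subset_span ⟨a, rfl⟩)

theorem pcd_exists_minor {k m : ℕ} (M : Matrix (Fin k) (Fin m) ℂ)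
    (h : Module.finrank ℂ (rowSpan M) = k) : ∃ s : Fin k → Fin m, (M.submatrix id s).det ≠ 0 := by
  have hr : M.rank = k := by
    rw [Matrix.rank_eq_finrank_span_row]; exact h
  rw [Matrix.rank_eq_finrank_span_cols] at hr
  obtain ⟨b, hb1, hb2, hb3⟩ := exists_linearIndependent ℂ (Set.range M.col)
  have htop : Submodule.span ℂ (Set.range M.col) = ⊤ := by
    apply Submodule.eq_top_of_finrank_eq
    rw [hr]; simp
  have hfin : b.Finite := (Set.finite_range _).subset hb1
  let _ : Fintype b := hfin.fintype
  have hcard : Fintype.card b = k := by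
    have := finrank_span_set_eq_card hb3
    rw [hb2, hr] at this
    rw [Set.toFinset_card] at this
    exact this.symm
  let e : Fin k ≃ b := (Fintype.equivFinOfCardEq hcard).symm
  have hs : ∀ i : Fin k, ∃ c, M.col c = (e i : Fin k → ℂ) := fun i => hb1 (e i).2
  choose s hs using hs
  refine ⟨s, ?_⟩
  have hli : LinearIndependent ℂ (fun i => (e i : Fin k → ℂ)) := hb3.comp e e.injective
  have hU : IsUnit (M.submatrix id s).transpose := by
    rw [← Matrix.linearIndependent_rows_iff_isUnit]
    have hrow : (M.submatrix id s).transpose.row = fun i => (e i : Fin k → ℂ) := by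
      funext i
      rw [← hs i]; rfl
    rw [hrow]
    exact hli
  rw [← Matrix.det_transpose]
  exact ((Matrix.isUnit_iff_isUnit_det _).mp hU).ne_zero

theorem pcd_chart {k m : ℕ} (M : Matrix (Fin k) (Fin m) ℂ) (s : Fin k → Fin m)
    (hs : (M.submatrix id s).det ≠ 0) :
    rowSpan (Matrix.of fun a b => plucker M (Function.update s a b)) = rowSpan M := by
  set A := M.submatrix id s with hA
  have hN : (Matrix.of fun a b => plucker M (Function.update s a b)) = A.adjugate * M := by
    ext a b
    have h1 : (A.adjugate * M) a b = (A.adjugate.mulVec (M.col b)) a := by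
      simp [Matrix.mul_apply, Matrix.mulVec, dotProduct, Matrix.col]
    rw [h1, ← Matrix.cramer_eq_adjugate_mulVec, Matrix.cramer_apply]
    simp only [Matrix.of_apply, plucker]
    congr 1
    ext i c
    by_cases hc : c = a
    · subst hc; simp [Matrix.col]
    · simp [hA, hc]
  rw [hN]
  apply le_antisymm (pcd_rowSpan_mul_le _ _)
  have : M = ((A.det)⁻¹ • A) * (A.adjugate * M) := by
    rw [← Matrix.mul_assoc, Matrix.smul_mul, Matrix.mul_adjugate, smul_smul, inv_mul_cancel₀ hs]
    simp
  conv_lhs => rw [this]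
  exact pcd_rowSpan_mul_le _ _

theorem pcd_closed {k m : ℕ} (T : Set ((Fin k → Fin m) → ℂ)) (Y : Set (Fin k × Fin m → ℂ))
    (hY : pcdZC Y)
    (hT : ∀ u ∈ T, ∃ M : Matrix (Fin k) (Fin m) ℂ, u = plucker M ∧
      ∀ N : Matrix (Fin k) (Fin m) ℂ, rowSpan N = rowSpan M → (fun x => N x.1 x.2) ∈ Y)
    (M₀ : Matrix (Fin k) (Fin m) ℂ) (hM₀ : Module.finrank ℂ (rowSpan M₀) = k)
    (h : plucker M₀ ∈ zClosure T) :
    ∃ N : Matrix (Fin k) (Fin m) ℂ, rowSpan N = rowSpan M₀ ∧ (fun x => N x.1 x.2) ∈ Y := by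
  obtain ⟨s, hs⟩ := pcd_exists_minor M₀ hM₀
  refine ⟨_, pcd_chart M₀ s hs, ?_⟩
  apply hY
  intro p hp
  have key := h (X s * bind₁ (fun x : Fin k × Fin m => X (Function.update s x.1 x.2)) p) ?_
  · rw [map_mul, eval_X, mul_eq_zero] at key
    rcases key with key | key
    · exact absurd key hs
    · have e : ∀ y : (Fin k → Fin m) → ℂ,
        eval y (bind₁ (fun x : Fin k × Fin m => X (Function.update s x.1 x.2)) p)
          = eval (fun x : Fin k × Fin m => y (Function.update s x.1 x.2)) p := by
        intro y
        rw [← aeval_eq_eval, aeval_bind₁, aeval_eq_eval]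
        simp
      rw [e] at key
      exact key
  · intro u hu
    obtain ⟨M, rfl, hM⟩ := hT u hu
    rw [map_mul, eval_X]
    by_cases hd : plucker M s = 0
    · rw [hd, zero_mul]
    · have := hp _ (hM _ (pcd_chart M s hd))
      rw [← aeval_eq_eval, aeval_bind₁, aeval_eq_eval]
      simp only [Matrix.of_apply, aeval_X] at this ⊢
      rw [this, mul_zero]


/-- dehomogenised form -/
def pcdPol (s : ℕ) (b : Fin (s+1) → ℂ) : Polynomial ℂ :=
  ∑ i : Fin (s+1), Polynomial.C (b i) * Polynomial.X ^ (i : ℕ)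

/-- coefficient vector -/
def pcdCf (s : ℕ) : Polynomial ℂ →ₗ[ℂ] (Fin (s+1) → ℂ) :=
  LinearMap.pi fun i => Polynomial.lcoeff ℂ i

theorem pcdCf_apply (s : ℕ) (p : Polynomial ℂ) (i : Fin (s+1)) : pcdCf s p i = p.coeff i := rfl

theorem pcdPol_coeff (s : ℕ) (b : Fin (s+1) → ℂ) (i : Fin (s+1)) : (pcdPol s b).coeff i = b i := by
  classical
  simp only [pcdPol, Polynomial.finsetSum_coeff, Polynomial.coeff_C_mul_X_pow]
  rw [Finset.sum_eq_single i]
  · simp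
  · intro k _ hk
    rw [if_neg]
    intro h; exact hk (Fin.ext h.symm)
  · simp

theorem pcdCf_pol (s : ℕ) (b : Fin (s+1) → ℂ) : pcdCf s (pcdPol s b) = b := by
  ext i; rw [pcdCf_apply, pcdPol_coeff]

theorem pcdPol_natDegree (s : ℕ) (b : Fin (s+1) → ℂ) : (pcdPol s b).natDegree ≤ s := by
  unfold pcdPol
  apply Polynomial.natDegree_sum_le_of_forall_le
  intro i _
  exact (Polynomial.natDegree_C_mul_X_pow_le _ _).trans (by omega)

theorem pcdPol_cf (s : ℕ) (p : Polynomial ℂ) (hp : p.natDegree ≤ s) : pcdPol s (pcdCf s p) = p := by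
  ext k
  by_cases hk : k ≤ s
  · exact pcdPol_coeff s _ ⟨k, by omega⟩
  · rw [Polynomial.coeff_eq_zero_of_natDegree_lt, Polynomial.coeff_eq_zero_of_natDegree_lt]
    · omega
    · have := pcdPol_natDegree s (pcdCf s p); omega

theorem pcdPol_inj (s : ℕ) : Function.Injective (pcdPol s) :=
  Function.LeftInverse.injective (pcdCf_pol s)

theorem pcdPol_ne_zero {s : ℕ} {b : Fin (s+1) → ℂ} : pcdPol s b ≠ 0 ↔ b ≠ 0 := by
  have h0 : pcdPol s 0 = 0 := by simp [pcdPol]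
  rw [not_iff_not, ← h0]
  exact (pcdPol_inj s).eq_iff

/-- dehomogenization -/
def pcdDeh : MvPolynomial (Fin 2) ℂ →ₐ[ℂ] Polynomial ℂ := aeval ![1, Polynomial.X]

theorem pcdDeh_binForm (r : ℕ) (a : Fin (r+1) → ℂ) : pcdDeh (binForm r a) = pcdPol r a := by
  simp only [pcdDeh, binForm, pcdPol, map_sum, map_mul, map_pow, aeval_X, Matrix.cons_val_zero,
    Matrix.cons_val_one, one_pow, mul_one]
  refine Finset.sum_congr rfl fun i _ => ?_
  rw [← algebraMap_eq, AlgHom.commutes]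
  rfl

/-- linear factor -/
def pcdLin (u v : ℂ) : Polynomial ℂ := Polynomial.C u + Polynomial.C v * Polynomial.X

theorem pcdDeh_linForm (u v : ℂ) : pcdDeh (linForm u v) = pcdLin u v := by
  simp only [pcdDeh, linForm, pcdLin, map_add, map_mul, aeval_X, Matrix.cons_val_zero,
    Matrix.cons_val_one, mul_one]
  rw [← algebraMap_eq, AlgHom.commutes, AlgHom.commutes]
  rfl

theorem pcd_homog_eval (p : MvPolynomial (Fin 2) ℂ) (r : ℕ) (hp : p.IsHomogeneous r) (c : ℂ)
    (x : Fin 2 → ℂ) : eval (c • x) p = c ^ r * eval x p := by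
  rw [eval_eq, eval_eq, Finset.mul_sum]
  refine Finset.sum_congr rfl fun d hd => ?_
  have hdeg : d.degree = r := by
    by_contra hne
    exact (mem_support_iff.mp hd) (hp.coeff_eq_zero hne)
  simp only [Pi.smul_apply, smul_eq_mul, mul_pow, Finset.prod_mul_distrib, Finset.prod_pow_eq_pow_sum]
  have : ∑ x ∈ d.support, d x = r := by rw [← hdeg]; rfl
  rw [this]; ring

theorem pcd_homog_ext (p q : MvPolynomial (Fin 2) ℂ) (r : ℕ) (hp : p.IsHomogeneous r)
    (hq : q.IsHomogeneous r) (h : pcdDeh p = pcdDeh q) : p = q := by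
  have h0 : (X 0 : MvPolynomial (Fin 2) ℂ) * p = X 0 * q := by
    apply MvPolynomial.funext
    intro x
    rw [map_mul, map_mul, eval_X]
    by_cases hx : x 0 = 0
    · rw [hx]; simp
    · congr 1
      have hx' : x = x 0 • ![1, x 1 / x 0] := by
        ext i; fin_cases i
        · simp
        · simp; field_simp
      have he : ∀ p : MvPolynomial (Fin 2) ℂ, eval ![1, x 1 / x 0] p
          = Polynomial.aeval (x 1 / x 0) (pcdDeh p) := by
        intro p
        have : (aeval ![1, x 1 / x 0] : MvPolynomial (Fin 2) ℂ →ₐ[ℂ] ℂ)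
            = (Polynomial.aeval (x 1 / x 0)).comp pcdDeh := by
          apply MvPolynomial.algHom_ext
          intro i
          fin_cases i <;> simp [pcdDeh]
        rw [← aeval_eq_eval, this]; rfl
      rw [hx', pcd_homog_eval _ _ hp, pcd_homog_eval _ _ hq, he, he, h]
  exact mul_left_cancel₀ (X_ne_zero 0) h0

theorem pcd_binForm_homog (r : ℕ) (a : Fin (r+1) → ℂ) : (binForm r a).IsHomogeneous r := by
  apply IsHomogeneous.sum
  intro i _
  have h1 := ((isHomogeneous_C (Fin 2) (a i)).mul (isHomogeneous_X_pow (R := ℂ) (0 : Fin 2) (r - i))).mul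
    (isHomogeneous_X_pow (R := ℂ) (1 : Fin 2) (i : ℕ))
  have : 0 + (r - (i : ℕ)) + i = r := by omega
  rwa [this] at h1

theorem pcd_crl_iff (r n : ℕ) (lam : Fin n → ℕ) (hr : ∑ i, lam i = r) (a : Fin (r+1) → ℂ) :
    a ∈ crlCone r n lam ↔ ∃ (t : ℂ) (u v : Fin n → ℂ),
      pcdPol r a = Polynomial.C t * ∏ i, pcdLin (u i) (v i) ^ lam i := by
  have hd : ∀ (t : ℂ) (u v : Fin n → ℂ), pcdDeh (C t * ∏ i, (linForm (u i) (v i)) ^ lam i)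
      = Polynomial.C t * ∏ i, pcdLin (u i) (v i) ^ lam i := by
    intro t u v
    rw [map_mul, map_prod]
    congr 1
    · rw [← algebraMap_eq, AlgHom.commutes]; rfl
    · refine Finset.prod_congr rfl fun i _ => ?_
      rw [map_pow, pcdDeh_linForm]
  constructor
  · rintro ⟨t, u, v, h⟩
    refine ⟨t, u, v, ?_⟩
    rw [← pcdDeh_binForm, h, hd]
  · rintro ⟨t, u, v, h⟩
    refine ⟨t, u, v, ?_⟩
    apply pcd_homog_ext _ _ r (pcd_binForm_homog r a)
    · have h1 : (∏ i, (linForm (u i) (v i)) ^ lam i).IsHomogeneous (∑ i, 1 * lam i) := by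
        apply IsHomogeneous.prod
        intro i _
        apply IsHomogeneous.pow
        exact (isHomogeneous_C_mul_X _ _).add (isHomogeneous_C_mul_X _ _)
      simp only [one_mul, hr] at h1
      have := (isHomogeneous_C (Fin 2) t).mul h1
      rwa [zero_add] at this
    · rw [pcdDeh_binForm, h, hd]

/-- weights -/
def pcdW (d k : ℕ) : ℂ := (Nat.factorial (d - k) : ℂ) * (Nat.factorial k : ℂ)

theorem pcdW_ne (d k : ℕ) : pcdW d k ≠ 0 :=
  mul_ne_zero (Nat.cast_ne_zero.mpr (Nat.factorial_ne_zero _)) (Nat.cast_ne_zero.mpr (Nat.factorial_ne_zero _))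

/-- the functional attached to a form -/
def pcdL (d : ℕ) (a : Fin (d+1) → ℂ) : Polynomial ℂ →ₗ[ℂ] ℂ :=
  ∑ i : Fin (d+1), (pcdW d i * a i) • Polynomial.lcoeff ℂ i

theorem pcdL_apply (d : ℕ) (a : Fin (d+1) → ℂ) (p : Polynomial ℂ) :
    pcdL d a p = ∑ i : Fin (d+1), pcdW d i * a i * p.coeff i := by
  simp [pcdL, LinearMap.sum_apply]

theorem pcdL_X_pow (d : ℕ) (a : Fin (d+1) → ℂ) (k : ℕ) (hk : k < d+1) :
    pcdL d a (Polynomial.X ^ k) = pcdW d k * a ⟨k, hk⟩ := by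
  rw [pcdL_apply, Finset.sum_eq_single ⟨k, hk⟩]
  · simp
  · intro i _ hi
    rw [Polynomial.coeff_X_pow, if_neg, mul_zero]
    intro h; exact hi (Fin.ext h)
  · simp

theorem pcd_pderiv_iter (p q A B : ℕ) (c : ℂ) :
    ((fun g => pderiv (0 : Fin 2) g)^[p] (((fun g => pderiv (1 : Fin 2) g)^[q])
      (C c * X 0 ^ A * X 1 ^ B : MvPolynomial (Fin 2) ℂ)))
    = C (c * (A.descFactorial p : ℂ) * (B.descFactorial q : ℂ)) * X 0 ^ (A - p) * X 1 ^ (B - q) := by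
  have h1 : ∀ q : ℕ, ((fun g => pderiv (1 : Fin 2) g)^[q])
      (C c * X 0 ^ A * X 1 ^ B : MvPolynomial (Fin 2) ℂ)
      = C (c * (B.descFactorial q : ℂ)) * X 0 ^ A * X 1 ^ (B - q) := by
    intro q
    induction q with
    | zero => simp
    | succ q ih =>
      rw [Function.iterate_succ_apply', ih, Nat.descFactorial_succ]
      simp only [Derivation.leibniz, Derivation.leibniz_pow, pderiv_C, pderiv_X_self,
        pderiv_X_of_ne (show (0 : Fin 2) ≠ 1 by decide), smul_zero, add_zero, smul_eq_mul, mul_one, nsmul_eq_mul,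
        zero_add, mul_zero]
      rw [Nat.sub_sub, show (((B - q : ℕ)) : MvPolynomial (Fin 2) ℂ) = C ((B - q : ℕ) : ℂ) by simp]
      push_cast
      simp only [C_mul]
      ring
  rw [h1]
  induction p with
  | zero => simp
  | succ p ih =>
    rw [Function.iterate_succ_apply', ih, Nat.descFactorial_succ]
    simp only [Derivation.leibniz, Derivation.leibniz_pow, pderiv_C, pderiv_X_self,
      pderiv_X_of_ne (show (1 : Fin 2) ≠ 0 by decide), smul_zero, add_zero, smul_eq_mul, mul_one, nsmul_eq_mul,
      zero_add, mul_zero]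
    rw [Nat.sub_sub, show (((A - p : ℕ)) : MvPolynomial (Fin 2) ℂ) = C ((A - p : ℕ) : ℂ) by simp]
    push_cast
    simp only [C_mul]
    ring

theorem pcd_iter_sum {ι : Type} (i : Fin 2) (p : ℕ) (s : Finset ι) (g : ι → MvPolynomial (Fin 2) ℂ) :
    (fun g => pderiv i g)^[p] (∑ k ∈ s, g k) = ∑ k ∈ s, (fun g => pderiv i g)^[p] (g k) := by
  induction p with
  | zero => simp
  | succ p ih =>
    rw [Function.iterate_succ_apply', ih, map_sum]
    refine Finset.sum_congr rfl fun k _ => ?_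
    rw [Function.iterate_succ_apply']

theorem pcdL_pol_mul_X (s e d : ℕ) (hd : d = s + e) (a : Fin (d+1) → ℂ) (b : Fin (s+1) → ℂ) (m : ℕ)
    (hm : m ≤ e) : pcdL d a (pcdPol s b * Polynomial.X ^ m)
      = ∑ i : Fin (s+1), b i * (pcdW d (i + m) * a ⟨i + m, by omega⟩) := by
  rw [pcdPol, Finset.sum_mul, map_sum]
  refine Finset.sum_congr rfl fun i _ => ?_
  rw [mul_assoc, ← pow_add, ← Polynomial.smul_eq_C_mul, map_smul, pcdL_X_pow d a _ (by omega), smul_eq_mul]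

theorem pcd_diffOp (s e d : ℕ) (hd : d = s + e) (a : Fin (d+1) → ℂ) (b : Fin (s+1) → ℂ) :
    diffOp s b (binForm d a) = binForm e (fun m : Fin (e+1) =>
      (pcdW e m)⁻¹ * pcdL d a (pcdPol s b * Polynomial.X ^ (m : ℕ))) := by
  have hterm : ∀ i : Fin (s+1), (fun g => pderiv (0 : Fin 2) g)^[s - (i : ℕ)]
      (((fun g => pderiv (1 : Fin 2) g)^[(i : ℕ)]) (binForm d a))
      = ∑ m : Fin (e+1), C ((pcdW e m)⁻¹ * (pcdW d (i + m) * a ⟨i + m, by omega⟩)) * X 0 ^ (e - (m : ℕ)) * X 1 ^ (m : ℕ) := by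
    intro i
    rw [binForm, pcd_iter_sum, pcd_iter_sum]
    simp only [pcd_pderiv_iter]
    let F : ℕ → MvPolynomial (Fin 2) ℂ := fun k =>
      C ((if h : k < d + 1 then a ⟨k, h⟩ else 0) * (((d - k).descFactorial (s - i) : ℕ) : ℂ) * ((k.descFactorial i : ℕ) : ℂ))
        * X 0 ^ (d - k - (s - i)) * X 1 ^ (k - i)
    have e1 : ∑ k : Fin (d+1), C (a k * (((d - k).descFactorial (s - i) : ℕ) : ℂ) * (((k : ℕ).descFactorial i : ℕ) : ℂ))
        * X 0 ^ (d - k - (s - i)) * X 1 ^ ((k : ℕ) - i) = ∑ k ∈ Finset.range (d+1), F k := by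
      rw [Finset.sum_range]
      refine Finset.sum_congr rfl fun k _ => ?_
      simp only [F]
      rw [dif_pos k.isLt]
    have e2 : ∑ k ∈ Finset.range (d+1), F k = ∑ k ∈ Finset.range ((i + (e + 1)) + (s - i)), F k := by
      congr 2
      omega
    rw [e1, e2, Finset.sum_range_add, Finset.sum_range_add]
    have z1 : ∑ k ∈ Finset.range i, F k = 0 := by
      apply Finset.sum_eq_zero
      intro k hk
      have : k.descFactorial i = 0 := Nat.descFactorial_eq_zero_iff_lt.mpr (Finset.mem_range.mp hk)
      simp [F, this]
    have z2 : ∑ k ∈ Finset.range (s - i), F (i + (e + 1) + k) = 0 := by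
      apply Finset.sum_eq_zero
      intro k hk
      have : (d - (i + (e + 1) + k)).descFactorial (s - i) = 0 := by
        apply Nat.descFactorial_eq_zero_iff_lt.mpr
        have := Finset.mem_range.mp hk
        omega
      simp only [F, this]
      simp
    rw [z1, z2, zero_add, add_zero, Finset.sum_range]
    refine Finset.sum_congr rfl fun m _ => ?_
    have hm : (m : ℕ) ≤ e := by omega
    have hi : (i : ℕ) ≤ s := by omega
    simp only [F]
    rw [dif_pos (show (i : ℕ) + m < d + 1 by omega), show d - (i + m) - (s - i) = e - m by omega,
      show (i : ℕ) + m - i = m by omega]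
    congr 3
    have f1 := Nat.factorial_mul_descFactorial (show s - (i : ℕ) ≤ d - (i + m) by omega)
    have f2 := Nat.factorial_mul_descFactorial (show (i : ℕ) ≤ i + m by omega)
    rw [show d - (i + m) - (s - (i : ℕ)) = e - m by omega] at f1
    rw [show (i : ℕ) + m - i = m by omega] at f2
    have hne := pcdW_ne e m
    have hW : pcdW d (i + m) = pcdW e m * (((d - (i + m)).descFactorial (s - i) : ℕ) : ℂ) * ((((i : ℕ) + m).descFactorial i : ℕ) : ℂ) := by
      unfold pcdW
      rw [← f1, ← f2]
      push_cast
      ring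
    rw [hW]
    field_simp
  unfold diffOp
  simp only [hterm]
  rw [binForm]
  simp only [Finset.smul_sum]
  rw [Finset.sum_comm]
  refine Finset.sum_congr rfl fun m _ => ?_
  rw [pcdL_pol_mul_X s e d hd a b m (by omega), Finset.mul_sum, map_sum, Finset.sum_mul, Finset.sum_mul]
  refine Finset.sum_congr rfl fun i _ => ?_
  rw [smul_eq_C_mul, ← mul_assoc, ← mul_assoc, ← C_mul]
  congr 3
  ring

theorem pcd_apolar_iff' (s e d : ℕ) (hd : d = s + e) (a : Fin (d+1) → ℂ) (b : Fin (s+1) → ℂ) :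
    b ∈ apolarSet d s a ↔ ∀ m : Fin (e+1), pcdL d a (pcdPol s b * Polynomial.X ^ (m : ℕ)) = 0 := by
  unfold apolarSet
  rw [Set.mem_ofPred_eq, pcd_diffOp s e d hd]
  constructor
  · intro h m
    have h1 := congrArg pcdDeh h
    rw [pcdDeh_binForm, map_zero] at h1
    have h2 := pcdPol_coeff e (fun m : Fin (e+1) =>
      (pcdW e m)⁻¹ * pcdL d a (pcdPol s b * Polynomial.X ^ (m : ℕ))) m
    rw [h1, Polynomial.coeff_zero] at h2
    exact (mul_eq_zero.mp h2.symm).resolve_left (inv_ne_zero (pcdW_ne _ _))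
  · intro h
    simp [h, binForm]

theorem pcd_apolar_iff (s e d : ℕ) (hd : d = s + e) (a : Fin (d+1) → ℂ) (b : Fin (s+1) → ℂ) :
    b ∈ apolarSet d s a ↔ ∀ Q : Polynomial ℂ, Q.natDegree ≤ e → pcdL d a (pcdPol s b * Q) = 0 := by
  rw [pcd_apolar_iff' s e d hd]
  constructor
  · intro h Q hQ
    rw [Polynomial.as_sum_range' Q (e+1) (by omega), Finset.mul_sum, map_sum]
    apply Finset.sum_eq_zero
    intro m hm
    rw [← Polynomial.C_mul_X_pow_eq_monomial, mul_left_comm, ← Polynomial.smul_eq_C_mul, map_smul,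
      h ⟨m, Finset.mem_range.mp hm⟩, smul_zero]
  · intro h m
    apply h
    rw [Polynomial.natDegree_X_pow]; omega


/-- `q`, seen as a form of degree `m`, kills the functional `L` on forms of degree `D`. -/
def pcdK (L : Polynomial ℂ →ₗ[ℂ] ℂ) (D m : ℕ) (q : Polynomial ℂ) : Prop :=
  ∀ Q : Polynomial ℂ, Q.degree < ((D + 1 - m : ℕ) : WithBot ℕ) → L (q * Q) = 0

theorem pcd_divide (u v : ℂ) (h : ¬ (u = 0 ∧ v = 0)) (q : Polynomial ℂ) (m : ℕ)
    (hq : q.degree < ((m + 1 : ℕ) : WithBot ℕ))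
    (hdiv : ¬ ∃ q' : Polynomial ℂ, q'.degree < (m : WithBot ℕ) ∧ q = pcdLin u v * q')
    (D : ℕ) (hD : m ≤ D) (R : Polynomial ℂ) (hR : R.degree < ((D + 1 : ℕ) : WithBot ℕ)) :
    ∃ A B : Polynomial ℂ, R = q * A + pcdLin u v * B ∧ A.degree < ((D + 1 - m : ℕ) : WithBot ℕ) ∧
      B.degree < (D : WithBot ℕ) := by
  have hdegfac : ∀ (S : Polynomial ℂ) (ρ : ℂ) (k : ℕ),
      ((Polynomial.X - Polynomial.C ρ) * S).degree < ((k + 1 : ℕ) : WithBot ℕ) → S.degree < (k : WithBot ℕ) := by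
    intro S ρ k hk
    by_cases hS : S = 0
    · rw [hS, Polynomial.degree_zero]; exact WithBot.bot_lt_coe _
    · rw [Polynomial.degree_mul, Polynomial.degree_X_sub_C, Polynomial.degree_eq_natDegree hS] at hk
      rw [Polynomial.degree_eq_natDegree hS]
      norm_cast at hk ⊢
      omega
  have hmulC : ∀ (p : Polynomial ℂ) (c : ℂ) (k : ℕ), p.degree < (k : WithBot ℕ) →
      (Polynomial.C c * p).degree < (k : WithBot ℕ) := by
    intro p c k hp
    rw [← Polynomial.smul_eq_C_mul]
    exact lt_of_le_of_lt (Polynomial.degree_smul_le c p) hp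
  by_cases hv : v = 0
  · have hu : u ≠ 0 := fun hu => h ⟨hu, hv⟩
    have hl : pcdLin u v = Polynomial.C u := by simp [pcdLin, hv]
    have hCu : Polynomial.C u * Polynomial.C u⁻¹ = 1 := by
      rw [← Polynomial.C_mul, mul_inv_cancel₀ hu, Polynomial.C_1]
    have hqm : q.coeff m ≠ 0 := by
      intro h0
      apply hdiv
      refine ⟨Polynomial.C u⁻¹ * q, hmulC _ _ _ ?_, ?_⟩
      · rw [Polynomial.degree_lt_iff_coeff_zero] at hq ⊢
        intro k hk
        rcases Nat.eq_or_lt_of_le hk with h1 | h1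
        · rw [← h1]; exact h0
        · exact hq k (by omega)
      · rw [hl, ← mul_assoc, hCu, one_mul]
    let c := R.coeff D / q.coeff m
    refine ⟨Polynomial.C c * Polynomial.X ^ (D - m), Polynomial.C u⁻¹ * (R - q * (Polynomial.C c * Polynomial.X ^ (D - m))), ?_, ?_, ?_⟩
    · rw [hl, ← mul_assoc (Polynomial.C u), hCu]; ring
    · refine lt_of_le_of_lt (Polynomial.degree_C_mul_X_pow_le _ _) ?_
      norm_cast; omega
    · apply hmulC
      rw [Polynomial.degree_lt_iff_coeff_zero] at hq hR ⊢
      intro k hk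
      rw [Polynomial.coeff_sub, show q * (Polynomial.C c * Polynomial.X ^ (D - m)) = Polynomial.C c * (q * Polynomial.X ^ (D - m)) by ring,
        Polynomial.coeff_C_mul, Polynomial.coeff_mul_X_pow', if_pos (by omega)]
      rcases Nat.eq_or_lt_of_le hk with h1 | h1
      · rw [← h1, show D - (D - m) = m by omega]
        simp only [c]
        field_simp
        ring
      · rw [hR k (by omega), hq (k - (D - m)) (by omega)]; ring
  · let ρ := - u / v
    have hl : pcdLin u v = Polynomial.C v * (Polynomial.X - Polynomial.C ρ) := by
      rw [mul_sub, ← Polynomial.C_mul, pcdLin, show v * ρ = -u by simp only [ρ]; field_simp, Polynomial.C_neg]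
      ring
    have hCv : Polynomial.C v * Polynomial.C v⁻¹ = 1 := by
      rw [← Polynomial.C_mul, mul_inv_cancel₀ hv, Polynomial.C_1]
    have key : ∀ (p : Polynomial ℂ) (k : ℕ), p.eval ρ = 0 → p.degree < ((k + 1 : ℕ) : WithBot ℕ) →
        ∃ p' : Polynomial ℂ, p'.degree < (k : WithBot ℕ) ∧ p = pcdLin u v * p' := by
      intro p k hp hdeg
      obtain ⟨S, hS⟩ := Polynomial.dvd_iff_isRoot.mpr hp
      refine ⟨Polynomial.C v⁻¹ * S, hmulC _ _ _ (hdegfac S ρ k (hS ▸ hdeg)), ?_⟩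
      rw [hl, hS]
      calc _ = (1 : Polynomial ℂ) * ((Polynomial.X - Polynomial.C ρ) * S) := by ring
        _ = _ := by rw [← hCv]; ring
    have hqρ : q.eval ρ ≠ 0 := fun h0 => hdiv (key q m h0 hq)
    let c := R.eval ρ / q.eval ρ
    obtain ⟨B, hB, hBe⟩ := key (R - q * Polynomial.C c) D (by simp [c]; field_simp; ring) (by
      refine lt_of_le_of_lt (Polynomial.degree_sub_le _ _) (max_lt hR ?_)
      rw [mul_comm]
      apply hmulC
      refine lt_of_lt_of_le hq ?_
      norm_cast; omega)
    refine ⟨Polynomial.C c, B, ?_, ?_, hB⟩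
    · rw [← hBe]; ring
    · refine lt_of_le_of_lt Polynomial.degree_C_le ?_
      norm_cast; omega

theorem pcd_select {α : Type} [DecidableEq α] (u v : α → ℂ) : ∀ (N : ℕ) (s : Finset α) (_ : s.card = N)
    (_ : ∀ i ∈ s, ¬ (u i = 0 ∧ v i = 0)) (m : ℕ) (q : Polynomial ℂ) (_ : q ≠ 0)
    (_ : q.degree < ((m + 1 : ℕ) : WithBot ℕ)) (D : ℕ) (_ : m + s.card ≤ D) (L : Polynomial ℂ →ₗ[ℂ] ℂ)
    (_ : pcdK L D m q) (_ : pcdK L D s.card (∏ i ∈ s, pcdLin (u i) (v i))),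
    ∃ I ⊆ s, I.card ≤ m ∧ pcdK L D I.card (∏ i ∈ I, pcdLin (u i) (v i)) := by
  intro N
  induction N with
  | zero =>
    intro s hs _ m q _ _ D _ L _ h
    exact ⟨s, subset_rfl, by omega, h⟩
  | succ N ih =>
    intro s hs hl m q hq0 hq D hD L hqk hsk
    by_cases hA : ∃ i ∈ s, ∃ q' : Polynomial ℂ, q'.degree < (m : WithBot ℕ) ∧ q = pcdLin (u i) (v i) * q'
    · obtain ⟨i, hi, q', hq', hqe⟩ := hA
      have hq'0 : q' ≠ 0 := by rintro rfl; exact hq0 (by rw [hqe, mul_zero])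
      have hm : 1 ≤ m := by
        rw [Polynomial.degree_eq_natDegree hq'0] at hq'
        norm_cast at hq'; omega
      have hc : (s.erase i).card = N := by rw [Finset.card_erase_of_mem hi, hs]; rfl
      obtain ⟨I, hI, hIc, hIk⟩ := ih (s.erase i) hc (fun k hk => hl k (Finset.mem_of_mem_erase hk)) (m - 1) q' hq'0
        (by rwa [show m - 1 + 1 = m by omega]) (D - 1) (by omega) (L.comp (LinearMap.mulLeft ℂ (pcdLin (u i) (v i))))
        (by
          intro Q hQ
          rw [LinearMap.comp_apply, LinearMap.mulLeft_apply, ← mul_assoc, ← hqe]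
          apply hqk
          rwa [show D - 1 + 1 - (m - 1) = D + 1 - m by omega] at hQ)
        (by
          intro Q hQ
          rw [LinearMap.comp_apply, LinearMap.mulLeft_apply, ← mul_assoc, Finset.mul_prod_erase s (fun i => pcdLin (u i) (v i)) hi]
          apply hsk
          rwa [show D - 1 + 1 - (s.erase i).card = D + 1 - s.card by omega] at hQ)
      have hiI : i ∉ I := fun h => Finset.notMem_erase i s (hI h)
      refine ⟨insert i I, Finset.insert_subset hi (hI.trans (Finset.erase_subset _ _)), ?_, ?_⟩
      · rw [Finset.card_insert_of_notMem hiI]; omega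
      · intro Q hQ
        rw [Finset.card_insert_of_notMem hiI] at hQ
        rw [Finset.prod_insert hiI, mul_assoc]
        apply hIk
        rwa [show D - 1 + 1 - I.card = D + 1 - (I.card + 1) by omega]
    · obtain ⟨i, hi⟩ : s.Nonempty := by rw [← Finset.card_pos]; omega
      have hc : (s.erase i).card = N := by rw [Finset.card_erase_of_mem hi, hs]; rfl
      obtain ⟨I, hI, hIc, hIk⟩ := ih (s.erase i) hc (fun k hk => hl k (Finset.mem_of_mem_erase hk)) m q hq0
        hq D (by omega) L hqk (by
          intro R hR
          obtain ⟨A, B, hRe, hAd, hBd⟩ := pcd_divide (u i) (v i) (hl i hi) q m hq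
            (fun ⟨q', h1, h2⟩ => hA ⟨i, hi, q', h1, h2⟩) (D - N) (by omega) R (by
              rwa [show D - N + 1 = D + 1 - (s.erase i).card by omega])
          rw [hRe, mul_add, map_add, mul_left_comm, ← mul_assoc _ (pcdLin _ _),
            Finset.prod_erase_mul s (fun i => pcdLin (u i) (v i)) hi, hsk, add_zero]
          · apply hqk
            by_cases hA0 : A = 0
            · rw [hA0, mul_zero, Polynomial.degree_zero]; exact WithBot.bot_lt_coe _
            have hPd : (∏ k ∈ s.erase i, pcdLin (u k) (v k)).natDegree ≤ N := by
              refine (Polynomial.natDegree_prod_le _ _).trans ?_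
              refine (Finset.sum_le_card_nsmul _ _ 1 ?_).trans (by rw [hc]; simp)
              intro k _
              unfold pcdLin
              compute_degree
            rw [Polynomial.degree_mul, Polynomial.degree_eq_natDegree hA0] at *
            have hAd' : A.natDegree < D - N + 1 - m := by exact_mod_cast hAd
            refine lt_of_le_of_lt (add_le_add_left Polynomial.degree_le_natDegree _) ?_
            norm_cast
            omega
          · rwa [show D + 1 - s.card = D - N by omega])
      exact ⟨I, hI.trans (Finset.erase_subset _ _), hIc, hIk⟩


theorem pcdLin_natDegree (u v : ℂ) : (pcdLin u v).natDegree ≤ 1 := by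
  unfold pcdLin
  compute_degree

theorem pcd_prod_natDegree {n : ℕ} (s : Finset (Fin n)) (u v : Fin n → ℂ) (e : Fin n → ℕ) :
    (∏ i ∈ s, pcdLin (u i) (v i) ^ e i).natDegree ≤ ∑ i ∈ s, e i := by
  refine (Polynomial.natDegree_prod_le _ _).trans (Finset.sum_le_sum fun i _ => ?_)
  refine Polynomial.natDegree_pow_le.trans ?_
  have := Nat.mul_le_mul_left (e i) (pcdLin_natDegree (u i) (v i))
  simpa using this

theorem pcd_degree_mul_lt (P Q : Polynomial ℂ) (a b : ℕ) (hP : P.natDegree ≤ a) (hQ : Q.degree < (b : WithBot ℕ)) :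
    (P * Q).degree < ((a + b : ℕ) : WithBot ℕ) := by
  by_cases hQ0 : Q = 0
  · rw [hQ0, mul_zero, Polynomial.degree_zero]; exact WithBot.bot_lt_coe _
  rw [Polynomial.degree_mul]
  rw [Polynomial.degree_eq_natDegree hQ0] at *
  have hQ' : Q.natDegree < b := by exact_mod_cast hQ
  refine lt_of_le_of_lt (add_le_add_left Polynomial.degree_le_natDegree _) ?_
  norm_cast
  omega

theorem pcd_iota (n j : ℕ) (hjn : j ≤ n) (lam : Fin n → ℕ) (hlam : ∀ i, 1 ≤ lam i) (u v : Fin n → ℂ)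
    (hl : ∀ i, ¬ (u i = 0 ∧ v i = 0)) (q : Polynomial ℂ) (hq0 : q ≠ 0)
    (hq : q.degree < ((n - j + 1 : ℕ) : WithBot ℕ)) (L : Polynomial ℂ →ₗ[ℂ] ℂ)
    (h1 : ∀ Q : Polynomial ℂ, Q.degree < ((n + 1 : ℕ) : WithBot ℕ) →
      L ((∏ i, pcdLin (u i) (v i) ^ (lam i - 1)) * (q * Q)) = 0)
    (h2 : ∀ Q : Polynomial ℂ, Q.degree < ((n - j + 1 : ℕ) : WithBot ℕ) →
      L ((∏ i, pcdLin (u i) (v i) ^ (lam i)) * Q) = 0) :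
    ∃ ι : Fin n → ℕ, (∀ i, ι i ≤ 1) ∧ ∑ i, ι i = j ∧
      ∀ Q : Polynomial ℂ, Q.degree < ((n + 1 : ℕ) : WithBot ℕ) →
        L ((∏ i, pcdLin (u i) (v i) ^ (lam i - ι i)) * Q) = 0 := by
  classical
  obtain ⟨I, hI, hIc, hIk⟩ := pcd_select u v n Finset.univ (by simp) (fun i _ => hl i) (n - j) q hq0 hq
    (2 * n - j) (by simp; omega)
    (L.comp (LinearMap.mulLeft ℂ (∏ i, pcdLin (u i) (v i) ^ (lam i - 1))))
    (by
      intro Q hQ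
      rw [LinearMap.comp_apply, LinearMap.mulLeft_apply]
      apply h1
      rwa [show 2 * n - j + 1 - (n - j) = n + 1 by omega] at hQ)
    (by
      intro Q hQ
      rw [LinearMap.comp_apply, LinearMap.mulLeft_apply, ← mul_assoc, ← Finset.prod_mul_distrib]
      rw [Finset.prod_congr rfl (g := fun i => pcdLin (u i) (v i) ^ (lam i))]
      · apply h2
        rwa [Finset.card_univ, Fintype.card_fin, show 2 * n - j + 1 - n = n - j + 1 by omega] at hQ
      · intro i _
        rw [← pow_succ, Nat.sub_add_cancel (hlam i)])
  obtain ⟨J, hIJ, hJc⟩ := Finset.exists_superset_card_eq (s := I) (n := n - j) hIc (by simp)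
  refine ⟨fun i => if i ∈ J then 0 else 1, ?_, ?_, ?_⟩
  · intro i; dsimp only; split_ifs <;> omega
  · rw [Finset.sum_congr rfl (g := fun i => if i ∈ Jᶜ then 1 else 0)]
    · rw [Finset.sum_boole, Finset.filter_mem_eq_inter, Finset.univ_inter, Finset.card_compl, hJc]
      simp; omega
    · intro i _
      by_cases h : i ∈ J <;> simp [h]
  · intro Q hQ
    have e1 : (∏ i, pcdLin (u i) (v i) ^ (lam i - (if i ∈ J then 0 else 1))) =
        (∏ i, pcdLin (u i) (v i) ^ (lam i - 1)) * ((∏ i ∈ I, pcdLin (u i) (v i)) * ∏ i ∈ J \ I, pcdLin (u i) (v i)) := by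
      rw [mul_comm (∏ i ∈ I, _), Finset.prod_sdiff hIJ, ← Finset.univ_inter J, ← Finset.prod_ite_mem Finset.univ J, ← Finset.prod_mul_distrib]
      refine Finset.prod_congr rfl fun i _ => ?_
      by_cases h : i ∈ J
      · simp only [Finset.univ_inter, h, if_true]
        rw [← pow_succ, Nat.sub_zero, Nat.sub_add_cancel (hlam i)]
      · simp [h]
    rw [e1, mul_assoc, mul_assoc]
    apply hIk
    have hd := pcd_prod_natDegree (J \ I) u v (fun _ => 1)
    simp only [pow_one, Finset.sum_const, smul_eq_mul, mul_one, Finset.card_sdiff_of_subset hIJ, hJc] at hd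
    have := pcd_degree_mul_lt _ Q _ _ hd hQ
    rwa [show n - j - I.card + (n + 1) = 2 * n - j + 1 - I.card by omega] at this


theorem pcd_fr_surj {p q : ℕ} (M : Matrix (Fin p) (Fin q) ℂ) :
    (∃ R : Matrix (Fin q) (Fin p) ℂ, M * R = 1) ↔ Function.Surjective M.mulVec :=
  Matrix.mulVec_surjective_iff_exists_right_inverse.symm

theorem pcd_fr_inj {p q : ℕ} (M : Matrix (Fin p) (Fin q) ℂ) :
    (∃ R : Matrix (Fin q) (Fin p) ℂ, M * R = 1) ↔ ∀ c : Fin p → ℂ, Matrix.vecMul c M = 0 → c = 0 := by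
  constructor
  · rintro ⟨R, hR⟩ c hc
    have : Matrix.vecMul c (M * R) = 0 := by rw [← Matrix.vecMul_vecMul, hc, Matrix.zero_vecMul]
    rwa [hR, Matrix.vecMul_one] at this
  · intro h
    have hinj : Function.Injective M.transpose.mulVec := by
      intro x y hxy
      have : Matrix.vecMul (x - y) M = 0 := by
        rw [← Matrix.mulVec_transpose, Matrix.mulVec_sub, sub_eq_zero]; exact hxy
      exact sub_eq_zero.mp (h _ this)
    obtain ⟨g, hg⟩ := LinearMap.exists_leftInverse_of_injective (Matrix.toLin' M.transpose)
      (LinearMap.ker_eq_bot.mpr hinj)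
    obtain ⟨R, hR⟩ : ∃ R : Matrix (Fin p) (Fin q) ℂ, R * M.transpose = 1 := by
      refine ⟨LinearMap.toMatrix' g, ?_⟩
      have h2 := congrArg LinearMap.toMatrix' hg
      rwa [LinearMap.toMatrix'_comp, LinearMap.toMatrix'_toLin', LinearMap.toMatrix'_id] at h2
    refine ⟨R.transpose, ?_⟩
    have := congrArg Matrix.transpose hR
    rwa [Matrix.transpose_mul, Matrix.transpose_transpose, Matrix.transpose_one] at this

theorem pcd_fr_det {p q : ℕ} (M : Matrix (Fin p) (Fin q) ℂ) (R : Matrix (Fin q) (Fin p) ℂ)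
    (h : (M * R).det ≠ 0) : ∃ R : Matrix (Fin q) (Fin p) ℂ, M * R = 1 := by
  refine ⟨R * (M * R)⁻¹, ?_⟩
  rw [← Matrix.mul_assoc, Matrix.mul_nonsing_inv _ (isUnit_iff_ne_zero.mpr h)]

theorem pcd_det_eval {p q : ℕ} (A : Matrix (Fin p) (Fin q) (Polynomial ℂ)) (R : Matrix (Fin q) (Fin p) ℂ) (t : ℂ) :
    ((A * R.map Polynomial.C).det).eval t = (A.map (Polynomial.eval t) * R).det := by
  have h := RingHom.map_det (Polynomial.evalRingHom t) (A * R.map Polynomial.C)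
  rw [Polynomial.coe_evalRingHom] at h
  rw [h]
  congr 1
  ext a b
  simp [Matrix.mul_apply, Polynomial.eval_finsetSum]

theorem pcd_poly_fin (p : Polynomial ℂ) (t₀ : ℂ) (h : p.eval t₀ ≠ 0) : {t | p.eval t = 0}.Finite := by
  have hp : p ≠ 0 := by rintro rfl; simp at h
  refine (p.roots.toFinset.finite_toSet).subset fun t ht => ?_
  simp only [Finset.mem_coe, Multiset.mem_toFinset]
  rw [Polynomial.mem_roots hp]
  exact ht

theorem pcd_fr_open {p q : ℕ} (A : Matrix (Fin p) (Fin q) (Polynomial ℂ)) (t₀ : ℂ)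
    (h : ∃ R : Matrix (Fin q) (Fin p) ℂ, A.map (Polynomial.eval t₀) * R = 1) :
    {t : ℂ | ¬ ∃ R : Matrix (Fin q) (Fin p) ℂ, A.map (Polynomial.eval t) * R = 1}.Finite := by
  obtain ⟨R, hR⟩ := h
  refine (pcd_poly_fin (A * R.map Polynomial.C).det t₀ ?_).subset fun t ht => ?_
  · rw [pcd_det_eval, hR]; simp
  · by_contra hne
    apply ht
    apply pcd_fr_det _ R
    rw [← pcd_det_eval]
    exact hne

/-- Hankel (catalecticant) matrix -/
def pcdH {R : Type} [CommRing R] [Algebra ℂ R] (s e d : ℕ) (hd : d = s + e) (a : Fin (d+1) → R) :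
    Matrix (Fin (e+1)) (Fin (s+1)) R :=
  fun m i => pcdW d (i + m) • a ⟨i + m, by omega⟩

theorem pcdH_apolar (s e d : ℕ) (hd : d = s + e) (a : Fin (d+1) → ℂ) (b : Fin (s+1) → ℂ) :
    b ∈ apolarSet d s a ↔ (pcdH s e d hd a).mulVec b = 0 := by
  rw [pcd_apolar_iff' s e d hd, _root_.funext_iff]
  refine forall_congr' fun m => ?_
  rw [pcdL_pol_mul_X s e d hd a b m (by omega)]
  simp only [Matrix.mulVec, dotProduct, pcdH, smul_eq_mul, Pi.zero_apply]
  simp only [mul_comm (b _)]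

theorem pcdH_apolar' (s e d : ℕ) (hd : d = s + e) (a : Fin (d+1) → ℂ) (b : Fin (e+1) → ℂ) :
    b ∈ apolarSet d e a ↔ Matrix.vecMul b (pcdH s e d hd a) = 0 := by
  rw [pcd_apolar_iff' e s d (by omega), _root_.funext_iff]
  refine forall_congr' fun m => ?_
  rw [pcdL_pol_mul_X e s d (by omega) a b m (by omega)]
  simp only [Matrix.vecMul, dotProduct, pcdH, smul_eq_mul, Pi.zero_apply]
  simp only [add_comm (m : ℕ)]

/-- no apolar forms of degree `e` -/
def pcdGood (d e : ℕ) (a : Fin (d+1) → ℂ) : Prop := ∀ b ∈ apolarSet d e a, b = 0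

theorem pcdGood_iff (s e d : ℕ) (hd : d = s + e) (a : Fin (d+1) → ℂ) :
    pcdGood d e a ↔ ∃ R : Matrix (Fin (s+1)) (Fin (e+1)) ℂ, pcdH s e d hd a * R = 1 := by
  rw [pcd_fr_inj]
  unfold pcdGood
  simp only [pcdH_apolar' s e d hd]

theorem pcd_good_open (s e d : ℕ) (hd : d = s + e) (c : Fin (d+1) → Polynomial ℂ) (t₀ : ℂ)
    (h : pcdGood d e (fun i => (c i).eval t₀)) : {t : ℂ | ¬ pcdGood d e (fun i => (c i).eval t)}.Finite := by
  have hm : ∀ t : ℂ, (pcdH s e d hd c).map (Polynomial.eval t) = pcdH s e d hd (fun i => (c i).eval t) := by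
    intro t
    ext m i
    simp [pcdH]
  simp only [pcdGood_iff s e d hd, ← hm] at h ⊢
  exact pcd_fr_open _ _ h

theorem pcd_span_apolar (s e d : ℕ) (hd : d = s + e) (a : Fin (d+1) → ℂ) :
    Submodule.span ℂ (apolarSet d s a) = LinearMap.ker (pcdH s e d hd a).mulVecLin := by
  have : apolarSet d s a = (LinearMap.ker (pcdH s e d hd a).mulVecLin : Set (Fin (s+1) → ℂ)) := by
    ext b
    rw [pcdH_apolar s e d hd]
    rfl
  rw [this, Submodule.span_eq]

theorem pcd_mem_span_apolar (s e d : ℕ) (hd : d = s + e) (a : Fin (d+1) → ℂ) (b : Fin (s+1) → ℂ) :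
    b ∈ Submodule.span ℂ (apolarSet d s a) ↔ b ∈ apolarSet d s a := by
  rw [pcd_span_apolar s e d hd, pcdH_apolar s e d hd]
  rfl

theorem pcd_good_finrank (s e d : ℕ) (hd : d = s + e) (hes : e ≤ s) (a : Fin (d+1) → ℂ) :
    Module.finrank ℂ (Submodule.span ℂ (apolarSet d s a)) = s - e ↔ pcdGood d e a := by
  rw [pcd_span_apolar s e d hd, pcdGood_iff s e d hd, pcd_fr_surj]
  have h := LinearMap.finrank_range_add_finrank_ker (pcdH s e d hd a).mulVecLin
  rw [Module.finrank_fin_fun] at h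
  have h2 : Function.Surjective (pcdH s e d hd a).mulVec ↔ LinearMap.range (pcdH s e d hd a).mulVecLin = ⊤ := by
    rw [LinearMap.range_eq_top]; rfl
  rw [h2]
  constructor
  · intro hk
    apply Submodule.eq_top_of_finrank_eq
    rw [Module.finrank_fin_fun]; omega
  · intro hk
    rw [hk, finrank_top, Module.finrank_fin_fun] at h
    omega

theorem pcd_exists_rows {m k : ℕ} (V : Submodule ℂ (Fin m → ℂ)) (hV : Module.finrank ℂ V = k) :
    ∃ M : Matrix (Fin k) (Fin m) ℂ, rowSpan M = V := by
  let b := Module.finBasisOfFinrankEq ℂ V hV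
  refine ⟨fun i => (b i : Fin m → ℂ), ?_⟩
  unfold rowSpan
  have h := b.span_eq
  have h2 := congrArg (Submodule.map V.subtype) h
  rw [Submodule.map_span, Submodule.map_top, Submodule.range_subtype, ← Set.range_comp] at h2
  exact h2

theorem pcd_pull_good (s e d : ℕ) (hd : d = s + e) (hes : e ≤ s) (T) (a : Fin (d+1) → ℂ)
    (h : a ∈ apolarPull d s (s - e) T) : pcdGood d e a := by
  obtain ⟨M, h1, h2, _⟩ := h
  rw [h1] at h2
  exact (pcd_good_finrank s e d hd hes a).mp h2

theorem pcd_good_rows (s e d : ℕ) (hd : d = s + e) (hes : e ≤ s) (a : Fin (d+1) → ℂ)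
    (h : pcdGood d e a) : ∃ M : Matrix (Fin (s - e)) (Fin (s+1)) ℂ,
      rowSpan M = Submodule.span ℂ (apolarSet d s a) ∧ Module.finrank ℂ (rowSpan M) = s - e := by
  have h1 := (pcd_good_finrank s e d hd hes a).mpr h
  obtain ⟨M, hM⟩ := pcd_exists_rows _ h1
  exact ⟨M, hM, by rw [hM]; exact h1⟩

/-- weaker degree condition -/
theorem pcd_good_mono (d e e' : ℕ) (h : e' ≤ e) (hed : e ≤ d) (a : Fin (d+1) → ℂ) (hg : pcdGood d e a) :
    pcdGood d e' a := by
  intro b hb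
  rw [pcd_apolar_iff e' (d - e') d (by omega)] at hb
  have hdeg := (pcdPol_natDegree e' b).trans h
  have := hg (pcdCf e (pcdPol e' b)) (by
    rw [pcd_apolar_iff e (d - e) d (by omega), pcdPol_cf _ _ hdeg]
    intro Q hQ
    exact hb Q (by omega))
  by_contra hne
  apply pcdPol_ne_zero.mpr hne
  rw [← pcdPol_cf e _ hdeg, this]
  simp [pcdPol]

/-- duality -/
theorem pcd_dual (s e d : ℕ) (hd : d = s + e) (a : Fin (d+1) → ℂ) (φ : Fin (s+1) → ℂ)
    (h : ∀ b ∈ apolarSet d s a, ∑ i, φ i * b i = 0) :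
    ∃ Q : Polynomial ℂ, Q.degree < ((e + 1 : ℕ) : WithBot ℕ) ∧
      ∀ b, ∑ i, φ i * b i = pcdL d a (pcdPol s b * Q) := by
  let Φ : (Fin (s+1) → ℂ) →ₗ[ℂ] ℂ := Fintype.linearCombination ℂ φ
  let Ψ : Fin (e+1) → ((Fin (s+1) → ℂ) →ₗ[ℂ] ℂ) := fun m => (LinearMap.proj m).comp (pcdH s e d hd a).mulVecLin
  have hΦ : ∀ b, Φ b = ∑ i, φ i * b i := by
    intro b; simp [Φ, Fintype.linearCombination_apply, mul_comm]
  have hmem : Φ ∈ Submodule.span ℂ (Set.range Ψ) := by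
    apply mem_span_of_iInf_ker_le_ker
    intro b hb
    rw [LinearMap.mem_ker, hΦ]
    apply h
    rw [pcdH_apolar s e d hd]
    ext m
    rw [Submodule.mem_iInf] at hb
    exact hb m
  obtain ⟨c, hc⟩ := (Submodule.mem_span_range_iff_exists_fun ℂ).mp hmem
  refine ⟨pcdPol e c, ?_, ?_⟩
  · refine lt_of_le_of_lt Polynomial.degree_le_natDegree ?_
    have := pcdPol_natDegree e c
    norm_cast; omega
  · intro b
    rw [← hΦ, ← hc, LinearMap.sum_apply]
    conv_rhs => rw [pcdPol.eq_1 e, Finset.mul_sum, map_sum]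
    refine Finset.sum_congr rfl fun m _ => ?_
    rw [mul_left_comm, ← Polynomial.smul_eq_C_mul, map_smul, pcdL_pol_mul_X s e d hd a b m (by omega)]
    simp only [Ψ, LinearMap.smul_apply, LinearMap.comp_apply, Matrix.mulVecLin_apply, LinearMap.proj_apply,
      Matrix.mulVec, dotProduct, pcdH, smul_eq_mul, mul_comm (b _)]


section
variable {K : Type} [Field K] {σ : Type} [Fintype σ] [DecidableEq σ]

theorem pcd_subset_zClosure (S : Set (σ → K)) : S ⊆ zClosure S := fun _ hx _ hp => hp _ hx

theorem pcd_zClosure_mono {S T : Set (σ → K)} (h : S ⊆ T) : zClosure S ⊆ zClosure T :=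
  fun _ hx p hp => hx p fun y hy => hp y (h hy)

theorem pcd_zClosure_min {S T : Set (σ → K)} (h : S ⊆ zClosure T) : zClosure S ⊆ zClosure T :=
  fun _ hx p hp => hx p fun _ hy => h hy p hp

end

theorem pcd_eval_aeval {σ : Type} (c : σ → Polynomial ℂ) (p : MvPolynomial σ ℂ) (t : ℂ) :
    (aeval c p).eval t = eval (fun i => (c i).eval t) p := by
  have : ((Polynomial.aeval t).comp (aeval c : MvPolynomial σ ℂ →ₐ[ℂ] Polynomial ℂ))
      = aeval (fun i => (c i).eval t) := by
    apply MvPolynomial.algHom_ext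
    intro i
    simp
  have h2 := congrArg (fun f => f p) this
  simp only [AlgHom.comp_apply] at h2
  rw [← aeval_eq_eval, ← h2, Polynomial.coe_aeval_eq_eval]

theorem pcd_poly_zero (P : Polynomial ℂ) (F : Set ℂ) (hF : F.Finite) (h : ∀ t, t ∉ F → P.eval t = 0) : P = 0 := by
  apply Polynomial.eq_zero_of_infinite_isRoot
  exact hF.infinite_compl.mono fun t ht => h t ht

theorem pcd_curve_closure {σ : Type} [Fintype σ] [DecidableEq σ] (c : σ → Polynomial ℂ) (S : Set (σ → ℂ))
    (F : Set ℂ) (hF : F.Finite) (h : ∀ t, t ∉ F → (fun i => (c i).eval t) ∈ S) (t₀ : ℂ) :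
    (fun i => (c i).eval t₀) ∈ zClosure S := by
  intro p hp
  rw [← pcd_eval_aeval, pcd_poly_zero (aeval c p) F hF, Polynomial.eval_zero]
  intro t ht
  rw [pcd_eval_aeval]
  exact hp _ (h t ht)

theorem pcd_two_inv {p q : ℕ} (A₀ A₁ : Matrix (Fin p) (Fin q) ℂ) (R₀ R₁ : Matrix (Fin q) (Fin p) ℂ)
    (h₀ : A₀ * R₀ = 1) (h₁ : A₁ * R₁ = 1) :
    ∃ R : Matrix (Fin q) (Fin p) ℂ, (A₀ * R).det ≠ 0 ∧ (A₁ * R).det ≠ 0 := by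
  let N : Matrix (Fin q) (Fin p) (Polynomial ℂ) := fun a b =>
    Polynomial.C (R₀ a b) + Polynomial.X * Polynomial.C (R₁ a b - R₀ a b)
  have key : ∀ (A : Matrix (Fin p) (Fin q) ℂ) (t : ℂ),
      ((N.transpose * A.transpose.map Polynomial.C).det).eval t
        = (A * N.map (Polynomial.eval t)).det := by
    intro A t
    rw [pcd_det_eval, ← Matrix.det_transpose, Matrix.transpose_mul, Matrix.transpose_transpose]
    rfl
  have n0 : N.map (Polynomial.eval 0) = R₀ := by ext a b; rw [Matrix.map_apply]; simp [N]
  have n1 : N.map (Polynomial.eval 1) = R₁ := by ext a b; rw [Matrix.map_apply]; simp [N]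
  have f0 := pcd_poly_fin (N.transpose * A₀.transpose.map Polynomial.C).det 0 (by rw [key, n0, h₀]; simp)
  have f1 := pcd_poly_fin (N.transpose * A₁.transpose.map Polynomial.C).det 1 (by rw [key, n1, h₁]; simp)
  obtain ⟨t, ht⟩ := (f0.union f1).exists_notMem
  refine ⟨N.map (Polynomial.eval t), ?_, ?_⟩
  · rw [← key]; exact fun h => ht (Or.inl h)
  · rw [← key]; exact fun h => ht (Or.inr h)

theorem pcd_eval_mulVec {p q : ℕ} (A : Matrix (Fin p) (Fin q) (Polynomial ℂ)) (w : Fin q → Polynomial ℂ) (t : ℂ) (i : Fin p) :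
    (A.mulVec w i).eval t = (A.map (Polynomial.eval t)).mulVec (fun k => (w k).eval t) i := by
  simp [Matrix.mulVec, dotProduct, Polynomial.eval_finsetSum]

theorem pcd_ker_curve {p q : ℕ} (A : Matrix (Fin p) (Fin q) (Polynomial ℂ))
    (h₀ : ∃ R : Matrix (Fin q) (Fin p) ℂ, A.map (Polynomial.eval 0) * R = 1)
    (h₁ : ∃ R : Matrix (Fin q) (Fin p) ℂ, A.map (Polynomial.eval 1) * R = 1) (a₀ a₁ : Fin q → ℂ)
    (ha₀ : (A.map (Polynomial.eval 0)).mulVec a₀ = 0) (ha₁ : (A.map (Polynomial.eval 1)).mulVec a₁ = 0) :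
    ∃ c : Fin q → Polynomial ℂ, (fun i => (c i).eval 0) = a₀ ∧
      (∃ κ : ℂ, κ ≠ 0 ∧ (fun i => (c i).eval 1) = κ • a₁) ∧
      ∀ t, (A.map (Polynomial.eval t)).mulVec (fun i => (c i).eval t) = 0 := by
  obtain ⟨R₀, h₀⟩ := h₀
  obtain ⟨R₁, h₁⟩ := h₁
  obtain ⟨R, hR0, hR1⟩ := pcd_two_inv _ _ R₀ R₁ h₀ h₁
  let B := A * R.map Polynomial.C
  let a : Fin q → Polynomial ℂ := fun i => Polynomial.C (a₀ i) + Polynomial.X * Polynomial.C (a₁ i - a₀ i)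
  let w : Fin q → Polynomial ℂ := B.det • a - (R.map Polynomial.C * B.adjugate).mulVec (A.mulVec a)
  have hw : A.mulVec w = 0 := by
    simp only [w]
    rw [Matrix.mulVec_sub, Matrix.mulVec_smul, Matrix.mulVec_mulVec, ← Matrix.mul_assoc, Matrix.mul_adjugate,
      Matrix.smul_mulVec, Matrix.one_mulVec, sub_self]
  have ha0 : (fun i => (a i).eval 0) = a₀ := by ext i; simp [a]
  have ha1 : (fun i => (a i).eval 1) = a₁ := by ext i; simp [a]
  have hwe : ∀ t : ℂ, (A.map (Polynomial.eval t)).mulVec (fun i => (a i).eval t) = 0 →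
      ∀ i, (w i).eval t = (B.det).eval t * (a i).eval t := by
    intro t ht i
    simp only [w, Pi.sub_apply, Pi.smul_apply, smul_eq_mul, Polynomial.eval_sub, Polynomial.eval_mul]
    rw [pcd_eval_mulVec]
    have : (fun k => (A.mulVec a k).eval t) = 0 := by
      rw [← ht]; ext k; rw [pcd_eval_mulVec]
    rw [this, Matrix.mulVec_zero, Pi.zero_apply, sub_zero]
  have hd0 : (B.det).eval 0 ≠ 0 := by rw [pcd_det_eval]; exact hR0
  have hd1 : (B.det).eval 1 ≠ 0 := by rw [pcd_det_eval]; exact hR1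
  refine ⟨fun i => Polynomial.C ((B.det).eval 0)⁻¹ * w i, ?_, ⟨((B.det).eval 0)⁻¹ * (B.det).eval 1, mul_ne_zero (inv_ne_zero hd0) hd1, ?_⟩, ?_⟩
  · ext i
    rw [Polynomial.eval_mul, Polynomial.eval_C, hwe 0 (by rw [ha0, ha₀]), congrFun ha0 i, ← mul_assoc,
      inv_mul_cancel₀ hd0, one_mul]
  · ext i
    rw [Polynomial.eval_mul, Polynomial.eval_C, hwe 1 (by rw [ha1, ha₁]), congrFun ha1 i, Pi.smul_apply, smul_eq_mul, mul_assoc]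
  · intro t
    ext k
    have h1 := congrArg (Polynomial.eval t) (congrFun hw k)
    rw [pcd_eval_mulVec] at h1
    have h2 : (fun i => (Polynomial.C ((B.det).eval 0)⁻¹ * w i).eval t) = ((B.det).eval 0)⁻¹ • fun i => (w i).eval t := by
      ext i; simp
    rw [h2, Matrix.mulVec_smul, Pi.smul_apply, h1]
    simp

/-- universal product along a line of linear forms -/
def pcdLine {n : ℕ} (μ : Fin n → ℕ) (u₀ v₀ u₁ v₁ : Fin n → ℂ) : Polynomial (Polynomial ℂ) :=
  ∏ i, (Polynomial.C (Polynomial.C (u₀ i) + Polynomial.X * Polynomial.C (u₁ i - u₀ i))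
    + Polynomial.C (Polynomial.C (v₀ i) + Polynomial.X * Polynomial.C (v₁ i - v₀ i)) * Polynomial.X) ^ μ i

/-- point on a line -/
def pcdPt {n : ℕ} (u₀ u₁ : Fin n → ℂ) (t : ℂ) : Fin n → ℂ := fun i => u₀ i + t * (u₁ i - u₀ i)

/-- product of powers of linear forms -/
def pcdPr {n : ℕ} (μ : Fin n → ℕ) (u v : Fin n → ℂ) : Polynomial ℂ := ∏ i, pcdLin (u i) (v i) ^ μ i

theorem pcdPr_natDegree {n : ℕ} (μ : Fin n → ℕ) (u v : Fin n → ℂ) : (pcdPr μ u v).natDegree ≤ ∑ i, μ i :=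
  pcd_prod_natDegree _ _ _ _

theorem pcdLin_ne {u v : ℂ} (h : ¬ (u = 0 ∧ v = 0)) : pcdLin u v ≠ 0 := by
  intro h0
  apply h
  have h1 := congrArg (fun p => Polynomial.coeff p 0) h0
  have h2 := congrArg (fun p => Polynomial.coeff p 1) h0
  simp [pcdLin] at h1 h2
  exact ⟨h1, h2⟩

theorem pcdPr_ne {n : ℕ} (μ : Fin n → ℕ) (u v : Fin n → ℂ) (h : ∀ i, ¬ (u i = 0 ∧ v i = 0)) : pcdPr μ u v ≠ 0 :=
  Finset.prod_ne_zero_iff.mpr fun i _ => pow_ne_zero _ (pcdLin_ne (h i))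

theorem pcdLine_eval {n : ℕ} (μ : Fin n → ℕ) (u₀ v₀ u₁ v₁ : Fin n → ℂ) (t : ℂ) :
    (pcdLine μ u₀ v₀ u₁ v₁).map (Polynomial.evalRingHom t) = pcdPr μ (pcdPt u₀ u₁ t) (pcdPt v₀ v₁ t) := by
  simp [pcdLine, pcdPr, pcdPt, pcdLin, Polynomial.map_prod]

theorem pcd_curve {n : ℕ} (μ : Fin n → ℕ) (s e d : ℕ) (hs : ∑ i, μ i = s) (hd : d = s + e)
    (u₀ v₀ u₁ v₁ : Fin n → ℂ) (h₀ : pcdPr μ u₀ v₀ ≠ 0) (h₁ : pcdPr μ u₁ v₁ ≠ 0) (a₀ a₁ : Fin (d+1) → ℂ)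
    (ha₀ : pcdCf s (pcdPr μ u₀ v₀) ∈ apolarSet d s a₀) (ha₁ : pcdCf s (pcdPr μ u₁ v₁) ∈ apolarSet d s a₁) :
    ∃ c : Fin (d+1) → Polynomial ℂ, (fun i => (c i).eval 0) = a₀ ∧
      (∃ κ : ℂ, κ ≠ 0 ∧ (fun i => (c i).eval 1) = κ • a₁) ∧
      ∀ t, pcdCf s (pcdPr μ (pcdPt u₀ u₁ t) (pcdPt v₀ v₁ t)) ∈ apolarSet d s (fun i => (c i).eval t) := by
  let A : Matrix (Fin (e+1)) (Fin (d+1)) (Polynomial ℂ) := fun m k =>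
    Polynomial.C (pcdW d k) * (pcdLine μ u₀ v₀ u₁ v₁ * Polynomial.X ^ (m : ℕ)).coeff k
  have hAe : ∀ t m k, (A.map (Polynomial.eval t)) m k
      = pcdW d k * (pcdPr μ (pcdPt u₀ u₁ t) (pcdPt v₀ v₁ t) * Polynomial.X ^ (m : ℕ)).coeff k := by
    intro t m k
    rw [← pcdLine_eval, ← Polynomial.map_X (Polynomial.evalRingHom t), ← Polynomial.map_pow, ← Polynomial.map_mul,
      Polynomial.coeff_map, Matrix.map_apply]
    simp [A]
  have hker : ∀ t (a : Fin (d+1) → ℂ), (A.map (Polynomial.eval t)).mulVec a = 0 ↔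
      pcdCf s (pcdPr μ (pcdPt u₀ u₁ t) (pcdPt v₀ v₁ t)) ∈ apolarSet d s a := by
    intro t a
    rw [pcd_apolar_iff' s e d hd, _root_.funext_iff, pcdPol_cf _ _ ((pcdPr_natDegree _ _ _).trans hs.le)]
    refine forall_congr' fun m => ?_
    rw [pcdL_apply]
    simp only [Matrix.mulVec, dotProduct, hAe, Pi.zero_apply]
    simp only [mul_right_comm]
  have hfr : ∀ t, pcdPr μ (pcdPt u₀ u₁ t) (pcdPt v₀ v₁ t) ≠ 0 →
      ∃ R : Matrix (Fin (d+1)) (Fin (e+1)) ℂ, A.map (Polynomial.eval t) * R = 1 := by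
    intro t ht
    rw [pcd_fr_inj]
    intro c hc
    by_contra hne
    have hP : pcdPr μ (pcdPt u₀ u₁ t) (pcdPt v₀ v₁ t) * pcdPol e c = 0 := by
      have hdeg : (pcdPr μ (pcdPt u₀ u₁ t) (pcdPt v₀ v₁ t) * pcdPol e c).natDegree ≤ d := by
        refine Polynomial.natDegree_mul_le.trans ?_
        have h1 := pcdPr_natDegree μ (pcdPt u₀ u₁ t) (pcdPt v₀ v₁ t)
        have h2 := pcdPol_natDegree e c
        omega
      ext k
      rw [Polynomial.coeff_zero]
      by_cases hk : k < d + 1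
      · have h1 := congrFun hc ⟨k, hk⟩
        simp only [Matrix.vecMul, dotProduct, hAe, Pi.zero_apply] at h1
        rw [pcdPol, Finset.mul_sum, Polynomial.finsetSum_coeff]
        have h2 : pcdW d k * ∑ m : Fin (e+1), (pcdPr μ (pcdPt u₀ u₁ t) (pcdPt v₀ v₁ t) * (Polynomial.C (c m) * Polynomial.X ^ (m : ℕ))).coeff k = 0 := by
          rw [← h1, Finset.mul_sum]
          refine Finset.sum_congr rfl fun m _ => ?_
          rw [mul_left_comm, Polynomial.coeff_C_mul]
          ring
        exact (mul_eq_zero.mp h2).resolve_left (pcdW_ne _ _)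
      · exact Polynomial.coeff_eq_zero_of_natDegree_lt (by omega)
    exact (mul_ne_zero ht (pcdPol_ne_zero.mpr hne)) hP
  have p0 : ∀ x y : Fin n → ℂ, pcdPt x y 0 = x := by intro x y; ext i; simp [pcdPt]
  have p1 : ∀ x y : Fin n → ℂ, pcdPt x y 1 = y := by intro x y; ext i; simp [pcdPt]
  obtain ⟨c, hc0, hc1, hct⟩ := pcd_ker_curve A (hfr 0 (by rw [p0, p0]; exact h₀)) (hfr 1 (by rw [p1, p1]; exact h₁)) a₀ a₁
    ((hker 0 a₀).mpr (by rw [p0, p0]; exact ha₀)) ((hker 1 a₁).mpr (by rw [p1, p1]; exact ha₁))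
  exact ⟨c, hc0, hc1, fun t => (hker t _).mp (hct t)⟩


theorem pcd_chain {σ : Type} [Fintype σ] [DecidableEq σ] (c : σ → Polynomial ℂ) (p : MvPolynomial σ ℂ) :
    Polynomial.derivative (aeval c p) = ∑ i, aeval c (pderiv i p) * Polynomial.derivative (c i) := by
  induction p using MvPolynomial.induction_on with
  | C a => simp
  | add p q hp hq => simp only [map_add, hp, hq, add_mul, Finset.sum_add_distrib]
  | mul_X p i hp =>
    simp only [map_mul, aeval_X, Polynomial.derivative_mul, hp, Derivation.leibniz, smul_eq_mul, map_add, add_mul, Finset.sum_add_distrib]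
    have : ∀ k, (aeval c) p * (aeval c) ((pderiv k) (X i : MvPolynomial σ ℂ)) * Polynomial.derivative (c k)
        = if k = i then (aeval c p) * Polynomial.derivative (c i) else 0 := by
      intro k
      by_cases h : k = i
      · subst h; simp
      · rw [pderiv_X_of_ne (Ne.symm h)]; simp [h]
    simp only [this, Finset.sum_ite_eq', Finset.mem_univ, if_true]
    rw [Finset.sum_mul, add_comm]
    refine congrArg₂ (· + ·) rfl (Finset.sum_congr rfl fun k _ => ?_)
    rw [mul_comm, mul_assoc]

theorem pcd_tangent_curve {σ : Type} [Fintype σ] [DecidableEq σ] (S : Set (σ → ℂ)) (c : σ → Polynomial ℂ)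
    (hc : ∀ t : ℂ, (fun k => (c k).eval t) ∈ S) :
    (fun k => (c k).coeff 1) ∈ zTangentAt S (fun k => (c k).coeff 0) := by
  intro p hp
  have h0 : aeval c p = 0 := by
    apply pcd_poly_zero _ ∅ Set.finite_empty
    intro t _
    rw [pcd_eval_aeval]
    exact hp _ (hc t)
  have h1 := pcd_chain c p
  rw [h0, Polynomial.derivative_zero] at h1
  have h2 := congrArg (Polynomial.eval 0) h1
  rw [Polynomial.eval_zero, Polynomial.eval_finsetSum] at h2
  rw [h2]
  refine Finset.sum_congr rfl fun i _ => ?_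
  rw [Polynomial.eval_mul, pcd_eval_aeval]
  simp only [← Polynomial.coeff_zero_eq_eval_zero, Polynomial.coeff_derivative]
  simp

/-- tangent space as a submodule -/
def pcdT {σ : Type} [Fintype σ] [DecidableEq σ] (S : Set (σ → ℂ)) (a : σ → ℂ) : Submodule ℂ (σ → ℂ) where
  carrier := zTangentAt S a
  zero_mem' := by intro p _; simp
  add_mem' := by
    intro x y hx hy p hp
    have h1 := hx p hp
    have h2 := hy p hp
    simp only [Pi.add_apply, mul_add, Finset.sum_add_distrib, h1, h2, add_zero]
  smul_mem' := by
    intro c x hx p hp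
    have h1 := hx p hp
    simp only [Pi.smul_apply, smul_eq_mul]
    simp only [mul_left_comm _ c]
    rw [← Finset.mul_sum, h1, mul_zero]

theorem pcdT_span {σ : Type} [Fintype σ] [DecidableEq σ] (S : Set (σ → ℂ)) (a : σ → ℂ) :
    Submodule.span ℂ (zTangentAt S a) = pcdT S a := Submodule.span_eq (pcdT S a)

theorem pcd_crl_mem (r n : ℕ) (lam : Fin n → ℕ) (hr : ∑ i, lam i = r) (t : ℂ) (u v : Fin n → ℂ) :
    pcdCf r (Polynomial.C t * pcdPr lam u v) ∈ crlCone r n lam := by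
  rw [pcd_crl_iff r n lam hr]
  refine ⟨t, u, v, ?_⟩
  rw [pcdPol_cf]
  · rfl
  · refine (Polynomial.natDegree_C_mul_le _ _).trans ((pcdPr_natDegree _ _ _).trans hr.le)

theorem pcd_T1_dir (r n : ℕ) (lam : Fin n → ℕ) (hlam : ∀ i, 1 ≤ lam i) (hr : ∑ i, lam i = r) (t : ℂ) (ht : t ≠ 0)
    (u v : Fin n → ℂ) (i : Fin n) :
    pcdCf r (pcdPr (fun k => lam k - 1) u v * ∏ k ∈ Finset.univ.erase i, pcdLin (u k) (v k)) ∈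
      pcdT (crlCone r n lam) (pcdCf r (Polynomial.C t * pcdPr lam u v)) := by
  classical
  obtain ⟨N, hN⟩ : ∃ N, lam i = N + 1 := ⟨lam i - 1, by have := hlam i; omega⟩
  let rest : Polynomial ℂ := ∏ k ∈ Finset.univ.erase i, pcdLin (u k) (v k) ^ lam k
  let y : ℕ → (Fin (r+1) → ℂ) := fun m => pcdCf r (Polynomial.C t * (rest * (pcdLin (u i) (v i) ^ m * (((N+1).choose m : ℕ) : Polynomial ℂ))))
  let c : Fin (r+1) → Polynomial ℂ := fun k => ∑ m ∈ Finset.range (N+1+1), Polynomial.C (y m k) * Polynomial.X ^ (N + 1 - m)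
  have hsplit : ∀ (e : Fin n → ℕ) (u' : Fin n → ℂ), pcdPr e u' v = pcdLin (u' i) (v i) ^ e i * ∏ k ∈ Finset.univ.erase i, pcdLin (u' k) (v k) ^ e k := by
    intro e u'
    rw [pcdPr, Finset.mul_prod_erase Finset.univ (fun k => pcdLin (u' k) (v k) ^ e k) (Finset.mem_univ i)]
  have hc : ∀ ε : ℂ, (fun k => (c k).eval ε) ∈ crlCone r n lam := by
    intro ε
    have : (fun k => (c k).eval ε) = pcdCf r (Polynomial.C t * pcdPr lam (Function.update u i (u i + ε)) v) := by
      have e1 : pcdPr lam (Function.update u i (u i + ε)) v = (pcdLin (u i) (v i) + Polynomial.C ε) ^ (N+1) * rest := by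
        rw [hsplit, hN]
        congr 1
        · rw [Function.update_self]; congr 1; simp [pcdLin]; ring
        · refine Finset.prod_congr rfl fun k hk => ?_
          rw [Function.update_of_ne (Finset.ne_of_mem_erase hk)]
      ext k
      rw [e1, add_pow, Finset.sum_mul, Finset.mul_sum, map_sum, Finset.sum_apply]
      simp only [c, Polynomial.eval_finsetSum]
      refine Finset.sum_congr rfl fun m _ => ?_
      simp only [y, Polynomial.eval_mul, Polynomial.eval_C, Polynomial.eval_pow, Polynomial.eval_X]
      have e2 : Polynomial.C t * (pcdLin (u i) (v i) ^ m * Polynomial.C ε ^ (N + 1 - m) * (((N+1).choose m : ℕ) : Polynomial ℂ) * rest)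
          = (ε ^ (N + 1 - m)) • (Polynomial.C t * (rest * (pcdLin (u i) (v i) ^ m * (((N+1).choose m : ℕ) : Polynomial ℂ)))) := by
        rw [Polynomial.smul_eq_C_mul, Polynomial.C_pow]; ring
      rw [e2, map_smul, Pi.smul_apply, smul_eq_mul, mul_comm]
    rw [this]
    exact pcd_crl_mem r n lam hr _ _ _
  have hT := pcd_tangent_curve _ c hc
  have c0 : (fun k => (c k).coeff 0) = pcdCf r (Polynomial.C t * pcdPr lam u v) := by
    ext k
    simp only [c]
    rw [Polynomial.finsetSum_coeff, Finset.sum_eq_single (N+1)]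
    · simp only [Nat.sub_self, pow_zero, mul_one, Polynomial.coeff_C_zero, y, Nat.choose_self, Nat.cast_one]
      rw [hsplit, hN, mul_comm (pcdLin _ _ ^ _)]
    · intro m hm hne
      have := Finset.mem_range.mp hm
      rw [Polynomial.coeff_C_mul_X_pow, if_neg (by omega)]
    · simp
  have c1 : (fun k => (c k).coeff 1) = (t * ((N + 1 : ℕ) : ℂ)) • pcdCf r (pcdPr (fun k => lam k - 1) u v * ∏ k ∈ Finset.univ.erase i, pcdLin (u k) (v k)) := by
    ext k
    simp only [c]
    rw [Polynomial.finsetSum_coeff, Finset.sum_eq_single N]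
    · rw [Polynomial.coeff_C_mul_X_pow, if_pos (by omega)]
      simp only [y]
      rw [← map_smul]
      refine congrArg (fun w => pcdCf r w k) ?_
      rw [hsplit, hN, mul_assoc (pcdLin _ _ ^ _), ← Finset.prod_mul_distrib, Polynomial.smul_eq_C_mul]
      have e3 : ∏ k ∈ Finset.univ.erase i, pcdLin (u k) (v k) ^ (lam k - 1) * pcdLin (u k) (v k) = rest := by
        refine Finset.prod_congr rfl fun k _ => ?_
        rw [← pow_succ, Nat.sub_add_cancel (hlam k)]
      rw [e3, Nat.choose_succ_self_right, Polynomial.C_mul, Polynomial.C_eq_natCast, Nat.add_sub_cancel]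
      ring
    · intro m hm hne
      have := Finset.mem_range.mp hm
      rw [Polynomial.coeff_C_mul_X_pow, if_neg (by omega)]
    · intro h
      exact absurd (Finset.mem_range.mpr (by omega)) h
  rw [c0, c1] at hT
  have hne : t * ((N + 1 : ℕ) : ℂ) ≠ 0 := mul_ne_zero ht (by exact_mod_cast Nat.succ_ne_zero N)
  exact (Submodule.smul_mem_iff (pcdT _ _) hne).mp hT

theorem pcd_T1_self (r n : ℕ) (lam : Fin n → ℕ) (hr : ∑ i, lam i = r) (t : ℂ)
    (u v : Fin n → ℂ) :
    pcdCf r (Polynomial.C t * pcdPr lam u v) ∈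
      pcdT (crlCone r n lam) (pcdCf r (Polynomial.C t * pcdPr lam u v)) := by
  let x := pcdCf r (Polynomial.C t * pcdPr lam u v)
  have h := pcd_tangent_curve (crlCone r n lam) (fun k => Polynomial.C (x k) + Polynomial.C (x k) * Polynomial.X) (by
    intro ε
    have : (fun k => (Polynomial.C (x k) + Polynomial.C (x k) * Polynomial.X).eval ε) = pcdCf r (Polynomial.C ((1 + ε) * t) * pcdPr lam u v) := by
      rw [Polynomial.C_mul, mul_assoc, ← Polynomial.smul_eq_C_mul, map_smul]
      ext k
      simp [x]; ring
    rw [this]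
    exact pcd_crl_mem r n lam hr _ _ _)
  have h0 : (fun k => (Polynomial.C (x k) + Polynomial.C (x k) * Polynomial.X).coeff 0) = x := by ext k; simp
  have h1 : (fun k => (Polynomial.C (x k) + Polynomial.C (x k) * Polynomial.X).coeff 1) = x := by
    ext k
    simp [Polynomial.coeff_C]
  rw [h0, h1] at h
  exact h


theorem pcd_partial_frac (n : ℕ) (u v : Fin n → ℂ) (hv : ∀ i, v i ≠ 0)
    (hd : ∀ i k, i ≠ k → u i * v k - u k * v i ≠ 0) (q : Polynomial ℂ) (hq : q.degree < ((n + 1 : ℕ) : WithBot ℕ)) :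
    ∃ (b : ℂ) (c : Fin n → ℂ), q = Polynomial.C b * ∏ k, pcdLin (u k) (v k) +
      ∑ i, Polynomial.C (c i) * ∏ k ∈ Finset.univ.erase i, pcdLin (u k) (v k) := by
  classical
  let ρ : Fin n → ℂ := fun i => - u i / v i
  have hev : ∀ i k, (pcdLin (u k) (v k)).eval (ρ i) = (u k * v i - u i * v k) / v i := by
    intro i k
    simp [pcdLin, ρ]
    have := hv i
    field_simp
    ring
  have hρ : Function.Injective ρ := by
    intro i k h
    by_contra hne
    apply hd i k hne
    have h1 := hv i
    have h2 := hv k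
    simp only [ρ] at h
    field_simp at h
    linear_combination -h
  have hP : ∀ s : Finset (Fin n), (∏ k ∈ s, pcdLin (u k) (v k)).natDegree = s.card ∧ (∏ k ∈ s, pcdLin (u k) (v k)) ≠ 0 := by
    intro s
    have hl : ∀ k, pcdLin (u k) (v k) ≠ 0 := fun k => pcdLin_ne fun h => hv k h.2
    refine ⟨?_, Finset.prod_ne_zero_iff.mpr fun k _ => hl k⟩
    rw [Polynomial.natDegree_prod _ _ fun k _ => hl k, Finset.sum_congr rfl (g := fun _ => 1)]
    · simp
    · intro k _
      rw [pcdLin, add_comm, Polynomial.natDegree_linear (hv k)]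
  let P := ∏ k, pcdLin (u k) (v k)
  have hPn : P.natDegree = n := by have := (hP Finset.univ).1; simpa using this
  have hP0 : P ≠ 0 := (hP Finset.univ).2
  have hPc : P.coeff n ≠ 0 := by
    have := Polynomial.leadingCoeff_ne_zero.mpr hP0
    rwa [Polynomial.leadingCoeff, hPn] at this
  let b := q.coeff n / P.coeff n
  let c : Fin n → ℂ := fun i => q.eval (ρ i) / (∏ k ∈ Finset.univ.erase i, pcdLin (u k) (v k)).eval (ρ i)
  refine ⟨b, c, ?_⟩
  rw [← sub_eq_zero]
  by_cases hn : n = 0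
  · subst hn
    simp only [Finset.univ_eq_empty, Finset.prod_empty, Finset.sum_empty, add_zero, mul_one]
    have h1 : q = Polynomial.C (q.coeff 0) := by
      rw [Polynomial.degree_lt_iff_coeff_zero] at hq
      ext m
      rcases m with _ | m
      · simp
      · rw [hq (m+1) (by omega), Polynomial.coeff_C_succ]
    have : b = q.coeff 0 := by simp [b, P]
    rw [this, ← h1, sub_self]
  apply Polynomial.eq_zero_of_natDegree_lt_card_of_eval_eq_zero _ hρ
  · intro i
    rw [Polynomial.eval_sub, Polynomial.eval_add, Polynomial.eval_mul, Polynomial.eval_finsetSum, Polynomial.eval_prod]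
    rw [Finset.prod_eq_zero (Finset.mem_univ i) (by rw [hev]; ring)]
    rw [Finset.sum_eq_single i]
    · rw [Polynomial.eval_mul, Polynomial.eval_C, Polynomial.eval_C]
      have : (∏ k ∈ Finset.univ.erase i, pcdLin (u k) (v k)).eval (ρ i) ≠ 0 := by
        rw [Polynomial.eval_prod, Finset.prod_ne_zero_iff]
        intro k hk
        rw [hev]
        exact div_ne_zero (hd k i (Finset.ne_of_mem_erase hk)) (hv i)
      simp only [c]
      field_simp
      ring
    · intro k _ hk
      rw [Polynomial.eval_mul, Polynomial.eval_prod, Finset.prod_eq_zero (i := i), mul_zero]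
      · exact Finset.mem_erase.mpr ⟨hk.symm, Finset.mem_univ _⟩
      · rw [hev]; ring
    · simp
  · have hE : (q - (Polynomial.C b * P + ∑ i, Polynomial.C (c i) * ∏ k ∈ Finset.univ.erase i, pcdLin (u k) (v k))).degree < (n : WithBot ℕ) := by
      rw [Polynomial.degree_lt_iff_coeff_zero] at hq ⊢
      intro m hm
      have hz : ∀ i, (Polynomial.C (c i) * ∏ k ∈ Finset.univ.erase i, pcdLin (u k) (v k)).coeff m = 0 := by
        intro i
        rw [Polynomial.coeff_C_mul, Polynomial.coeff_eq_zero_of_natDegree_lt, mul_zero]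
        rw [(hP _).1, Finset.card_erase_of_mem (Finset.mem_univ i)]
        simp; omega
      rw [Polynomial.coeff_sub, Polynomial.coeff_add, Polynomial.finsetSum_coeff, Finset.sum_eq_zero fun i _ => hz i, Polynomial.coeff_C_mul]
      rcases Nat.eq_or_lt_of_le hm with h | h
      · rw [← h]
        simp only [b]
        field_simp
        ring
      · rw [hq m (by omega), Polynomial.coeff_eq_zero_of_natDegree_lt (p := P) (by omega)]; ring
    by_cases h0 : (q - (Polynomial.C b * P + ∑ i, Polynomial.C (c i) * ∏ k ∈ Finset.univ.erase i, pcdLin (u k) (v k))) = 0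
    · rw [h0]; simp; omega
    · rw [Polynomial.degree_eq_natDegree h0] at hE
      rw [Fintype.card_fin]
      exact_mod_cast hE

theorem pcd_T1_gen (r n : ℕ) (lam : Fin n → ℕ) (hlam : ∀ i, 1 ≤ lam i) (hr : ∑ i, lam i = r) (t : ℂ) (ht : t ≠ 0)
    (u v : Fin n → ℂ) (hv : ∀ i, v i ≠ 0)
    (hd : ∀ i k, i ≠ k → u i * v k - u k * v i ≠ 0) (q : Polynomial ℂ) (hq : q.degree < ((n + 1 : ℕ) : WithBot ℕ)) :
    pcdCf r (pcdPr (fun k => lam k - 1) u v * q) ∈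
      pcdT (crlCone r n lam) (pcdCf r (Polynomial.C t * pcdPr lam u v)) := by
  obtain ⟨b, c, rfl⟩ := pcd_partial_frac n u v hv hd q hq
  rw [mul_add, map_add, Finset.mul_sum, map_sum]
  refine Submodule.add_mem _ ?_ (Submodule.sum_mem _ fun i _ => ?_)
  · have : pcdPr (fun k => lam k - 1) u v * (Polynomial.C b * ∏ k, pcdLin (u k) (v k))
        = (b * t⁻¹) • (Polynomial.C t * pcdPr lam u v) := by
      rw [mul_left_comm, pcdPr, ← Finset.prod_mul_distrib, Polynomial.smul_eq_C_mul, ← mul_assoc (Polynomial.C _), ← Polynomial.C_mul,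
        mul_assoc, inv_mul_cancel₀ ht, mul_one]
      refine congrArg (fun w => Polynomial.C b * w) (Finset.prod_congr rfl fun k _ => ?_)
      rw [← pow_succ, Nat.sub_add_cancel (hlam k)]
    rw [this, map_smul]
    exact Submodule.smul_mem _ _ (pcd_T1_self r n lam hr t u v)
  · have e1 : pcdPr (fun k => lam k - 1) u v * (Polynomial.C (c i) * ∏ k ∈ Finset.univ.erase i, pcdLin (u k) (v k))
        = c i • (pcdPr (fun k => lam k - 1) u v * ∏ k ∈ Finset.univ.erase i, pcdLin (u k) (v k)) := by
      rw [Polynomial.smul_eq_C_mul]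
      exact mul_left_comm _ _ _
    have e2 := Submodule.smul_mem _ (c i) (pcd_T1_dir r n lam hlam hr t ht u v i)
    rw [← map_smul, ← e1] at e2
    exact e2

/-- generic line endpoint -/
theorem pcd_line_gen (n : ℕ) (u₀ v₀ : Fin n → ℂ) (u₁ v₁ : Fin n → ℂ) (hv : ∀ i, v₁ i ≠ 0)
    (hd : ∀ i k, i ≠ k → u₁ i * v₁ k - u₁ k * v₁ i ≠ 0) :
    ∃ F : Set ℂ, F.Finite ∧ ∀ t, t ∉ F → (∀ i, pcdPt v₀ v₁ t i ≠ 0) ∧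
      ∀ i k, i ≠ k → pcdPt u₀ u₁ t i * pcdPt v₀ v₁ t k - pcdPt u₀ u₁ t k * pcdPt v₀ v₁ t i ≠ 0 := by
  let U : (Fin n → ℂ) → (Fin n → ℂ) → Fin n → Polynomial ℂ := fun x y i =>
    Polynomial.C (x i) + Polynomial.X * Polynomial.C (y i - x i)
  have hU : ∀ x y i t, (U x y i).eval t = pcdPt x y t i := by intro x y i t; simp [U, pcdPt]
  have hp1 : ∀ x y : Fin n → ℂ, ∀ i, pcdPt x y 1 i = y i := by intro x y i; simp [pcdPt]
  let F1 : Set ℂ := ⋃ i, {t | (U v₀ v₁ i).eval t = 0}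
  let F2 : Set ℂ := ⋃ p : {p : Fin n × Fin n // p.1 ≠ p.2}, {t | (U u₀ u₁ p.1.1 * U v₀ v₁ p.1.2 - U u₀ u₁ p.1.2 * U v₀ v₁ p.1.1).eval t = 0}
  refine ⟨F1 ∪ F2, ?_, ?_⟩
  · refine Set.Finite.union (Set.finite_iUnion fun i => ?_) (Set.finite_iUnion fun p => ?_)
    · apply pcd_poly_fin _ 1
      rw [hU, hp1]; exact hv i
    · apply pcd_poly_fin _ 1
      rw [Polynomial.eval_sub, Polynomial.eval_mul, Polynomial.eval_mul, hU, hU, hU, hU, hp1, hp1, hp1, hp1]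
      exact hd _ _ p.2
  · intro t ht
    refine ⟨fun i h => ht (Or.inl (Set.mem_iUnion.mpr ⟨i, ?_⟩)), fun i k hik h => ht (Or.inr (Set.mem_iUnion.mpr ⟨⟨(i, k), hik⟩, ?_⟩))⟩
    · change (U v₀ v₁ i).eval t = 0
      rw [hU]; exact h
    · change (U u₀ u₁ i * U v₀ v₁ k - U u₀ u₁ k * U v₀ v₁ i).eval t = 0
      rw [Polynomial.eval_sub, Polynomial.eval_mul, Polynomial.eval_mul, hU, hU, hU, hU]; exact h

theorem pcd_T1 (r n : ℕ) (lam : Fin n → ℕ) (hlam : ∀ i, 1 ≤ lam i) (hr : ∑ i, lam i = r) (t : ℂ) (ht : t ≠ 0)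
    (u v : Fin n → ℂ) (q : Polynomial ℂ) (hq : q.degree < ((n + 1 : ℕ) : WithBot ℕ)) :
    pcdCf r (pcdPr (fun k => lam k - 1) u v * q) ∈
      pcdT (crlCone r n lam) (pcdCf r (Polynomial.C t * pcdPr lam u v)) := by
  let u₁ : Fin n → ℂ := fun i => -((i : ℕ) : ℂ)
  let v₁ : Fin n → ℂ := fun i => 1
  obtain ⟨F, hF, hgen⟩ := pcd_line_gen n u v u₁ v₁ (fun i => one_ne_zero) (by
    intro i k hik
    simp only [u₁, v₁, mul_one]
    intro h
    apply hik
    have : ((k : ℕ) : ℂ) = ((i : ℕ) : ℂ) := by linear_combination h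
    exact Fin.ext (by exact_mod_cast this.symm))
  intro p hp
  let c : Fin (r+1) → Polynomial ℂ := fun k => Polynomial.C t * (pcdLine lam u v u₁ v₁).coeff k
  let w : Fin (r+1) → Polynomial ℂ := fun k => (pcdLine (fun k => lam k - 1) u v u₁ v₁ * q.map Polynomial.C).coeff k
  have hc : ∀ s : ℂ, (fun k => (c k).eval s) = pcdCf r (Polynomial.C t * pcdPr lam (pcdPt u u₁ s) (pcdPt v v₁ s)) := by
    intro s
    ext k
    rw [pcdCf_apply, Polynomial.coeff_C_mul, ← pcdLine_eval, Polynomial.coeff_map]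
    simp [c]
  have hw : ∀ s : ℂ, (fun k => (w k).eval s) = pcdCf r (pcdPr (fun k => lam k - 1) (pcdPt u u₁ s) (pcdPt v v₁ s) * q) := by
    intro s
    ext k
    have hq' : q = (q.map Polynomial.C).map (Polynomial.evalRingHom s) := by
      rw [Polynomial.map_map]
      have : (Polynomial.evalRingHom s).comp Polynomial.C = RingHom.id ℂ := by ext x; simp
      rw [this, Polynomial.map_id]
    conv_rhs => rw [hq']
    rw [pcdCf_apply, ← pcdLine_eval, ← Polynomial.map_mul, Polynomial.coeff_map]
    simp [w]
  let G : Polynomial ℂ := ∑ k, aeval c (pderiv k p) * w k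
  have hG : ∀ s, G.eval s = ∑ k, eval (pcdCf r (Polynomial.C t * pcdPr lam (pcdPt u u₁ s) (pcdPt v v₁ s))) (pderiv k p) *
      pcdCf r (pcdPr (fun k => lam k - 1) (pcdPt u u₁ s) (pcdPt v v₁ s) * q) k := by
    intro s
    simp only [G, Polynomial.eval_finsetSum, Polynomial.eval_mul, pcd_eval_aeval, hc]
    refine Finset.sum_congr rfl fun k _ => ?_
    rw [← hw]
  have hz : G = 0 := by
    apply pcd_poly_zero _ F hF
    intro s hs
    rw [hG]
    exact pcd_T1_gen r n lam hlam hr t ht _ _ (hgen s hs).1 (hgen s hs).2 q hq p hp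
  have h0 := hG 0
  have p0 : ∀ x y : Fin n → ℂ, pcdPt x y 0 = x := by intro x y; ext i; simp [pcdPt]
  rw [hz, Polynomial.eval_zero, p0, p0] at h0
  exact h0.symm


theorem pcd_indep_iff {σ τ : Type} (y : σ → MvPolynomial τ ℂ) (s : Set σ) :
    AlgebraicIndepOn ℂ y s ↔ ∀ p : MvPolynomial σ ℂ, ↑p.vars ⊆ s → aeval y p = 0 → p = 0 := by
  unfold AlgebraicIndepOn
  rw [algebraicIndependent_iff]
  constructor
  · intro h p hp h0
    obtain ⟨q, rfl⟩ := exists_rename_eq_of_vars_subset_range p (Subtype.val : s → σ) Subtype.val_injective (by simpa using hp)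
    rw [aeval_rename] at h0
    rw [h q h0, map_zero]
  · intro h q h0
    refine rename_injective (Subtype.val : s → σ) Subtype.val_injective ?_
    rw [map_zero]
    refine h _ ?_ ?_
    · classical
      intro i hi
      have := vars_rename (Subtype.val : s → σ) q hi
      obtain ⟨j, -, rfl⟩ := Finset.mem_image.mp this
      exact j.2
    · rw [aeval_rename]; exact h0

theorem pcd_pderiv_supp {σ : Type} (k : σ) (p : MvPolynomial σ ℂ) (m : σ →₀ ℕ)
    (hm : m ∈ (pderiv k p).support) : m + Finsupp.single k 1 ∈ p.support := by
  rw [mem_support_iff, coeff_pderiv] at hm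
  rw [mem_support_iff]
  intro h
  exact hm (by simp [h])

theorem pcd_pderiv_rel {σ τ : Type} (y : σ → MvPolynomial τ ℂ) (s : Set σ) (k : σ)
    (hs : AlgebraicIndepOn ℂ y s) (hk : ¬ AlgebraicIndepOn ℂ y (insert k s)) :
    ∃ p : MvPolynomial σ ℂ, ↑p.vars ⊆ insert k s ∧ aeval y p = 0 ∧ aeval y (pderiv k p) ≠ 0 := by
  classical
  rw [pcd_indep_iff] at hs hk
  push Not at hk
  obtain ⟨p, hp, h0, hne⟩ := hk
  by_contra! hcon
  have key : ∀ N : ℕ, ∀ p : MvPolynomial σ ℂ, degreeOf k p ≤ N → ↑p.vars ⊆ insert k s → aeval y p = 0 → p = 0 := by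
    intro N
    induction N with
    | zero =>
      intro p hd hp h0
      refine hs p ?_ h0
      intro i hi
      rcases hp hi with rfl | h
      · exfalso
        obtain ⟨m, hm, him⟩ := (mem_vars_iff_mem_support i) |>.mp hi
        have := (degreeOf_le_iff.mp hd) m hm
        exact (Finsupp.mem_support_iff.mp him) (by omega)
      · exact h
    | succ N ih =>
      intro p hd hp h0
      have h1 : pderiv k p = 0 := by
        refine ih _ ?_ ?_ (hcon p hp h0)
        · rw [degreeOf_le_iff]
          intro m hm
          have := (degreeOf_le_iff.mp hd) _ (pcd_pderiv_supp k p m hm)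
          simp at this
          exact this
        · intro i hi
          obtain ⟨m, hm, him⟩ := (mem_vars_iff_mem_support i) |>.mp hi
          refine hp ((mem_vars_iff_mem_support i) |>.mpr ⟨_, pcd_pderiv_supp k p m hm, ?_⟩)
          rw [Finsupp.mem_support_iff] at him ⊢
          simp only [Finsupp.add_apply]; omega
      refine ih p ?_ hp h0
      rw [degreeOf_le_iff]
      intro m hm
      by_contra hc
      have hle : Finsupp.single k 1 ≤ m := by
        rw [Finsupp.single_le_iff]; omega
      have hc2 : coeff (m - Finsupp.single k 1) (pderiv k p) = 0 := by rw [h1]; simp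
      rw [coeff_pderiv, tsub_add_cancel_of_le hle] at hc2
      rcases mul_eq_zero.mp hc2 with h | h
      · exact (mem_support_iff.mp hm) h
      · exact absurd h (Nat.cast_add_one_ne_zero _)
  exact hne (key _ p le_rfl hp h0)

theorem pcd_generic_tangent {m : ℕ} {τ : Type} [Fintype τ] (y : Fin m → MvPolynomial τ ℂ)
    (S : Set (Fin m → ℂ)) (hS : ∀ p, aeval y p = 0 → ∀ x ∈ S, eval x p = 0) :
    ∃ D : MvPolynomial (Fin m) ℂ, aeval y D ≠ 0 ∧
      ∀ x, eval x D ≠ 0 → zTangentDim S x ≤ Fintype.card τ := by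
  classical
  have hex : ∃ I : Finset (Fin m), AlgebraicIndepOn ℂ y (I : Set (Fin m)) ∧
      ∀ k, k ∉ I → ¬ AlgebraicIndepOn ℂ y (insert k (I : Set (Fin m))) := by
    have hemp : AlgebraicIndepOn ℂ y ((∅ : Finset (Fin m)) : Set (Fin m)) := by
      rw [pcd_indep_iff]
      intro p hp h0
      have hv : p.vars = ∅ := by
        rw [← Finset.coe_eq_empty]; exact Set.subset_empty_iff.mp (by simpa using hp)
      obtain ⟨c, rfl⟩ := (⟨_, vars_eq_empty_iff_eq_C.mp hv⟩ : ∃ c, p = C c)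
      simpa using h0
    obtain ⟨I, hI, hmax⟩ := Finset.exists_max_image
      (Finset.univ.filter fun I : Finset (Fin m) => AlgebraicIndepOn ℂ y (I : Set (Fin m))) Finset.card
      ⟨∅, by simpa using hemp⟩
    refine ⟨I, (Finset.mem_filter.mp hI).2, fun k hk h => ?_⟩
    have := hmax (insert k I) (by simpa using h)
    rw [Finset.card_insert_of_notMem hk] at this
    omega
  obtain ⟨I, hI, hmax⟩ := hex
  have hcard : I.card ≤ Fintype.card τ := by
    have h := AlgebraicIndependent.cardinalMk_le_trdeg hI
    rw [MvPolynomial.trdeg_of_isDomain] at h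
    simpa using h
  have hrel := fun k (hk : k ∉ I) => pcd_pderiv_rel y (I : Set (Fin m)) k hI (hmax k hk)
  choose! p hp h0 hd using hrel
  refine ⟨∏ k ∈ Iᶜ, pderiv k (p k), ?_, ?_⟩
  · rw [map_prod, Finset.prod_ne_zero_iff]
    intro k hk
    exact hd k (Finset.mem_compl.mp hk)
  · intro x hx
    rw [map_prod, Finset.prod_ne_zero_iff] at hx
    unfold zTangentDim
    rw [pcdT_span]
    let f : pcdT S x →ₗ[ℂ] (I → ℂ) :=
      (LinearMap.funLeft ℂ ℂ (Subtype.val : I → Fin m)).comp (pcdT S x).subtype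
    have hf : Function.Injective f := by
      rw [← LinearMap.ker_eq_bot, LinearMap.ker_eq_bot']
      intro w hw
      have hw0 : ∀ i ∈ I, (w : Fin m → ℂ) i = 0 := fun i hi => congrFun hw ⟨i, hi⟩
      ext k
      by_cases hk : k ∈ I
      · exact hw0 k hk
      · have h1 := w.2 (p k) (hS (p k) (h0 k hk))
        rw [Finset.sum_eq_single k] at h1
        · exact (mul_eq_zero.mp h1).resolve_left (hx k (Finset.mem_compl.mpr hk))
        · intro i _ hik
          by_cases hi : i ∈ I
          · rw [hw0 i hi, mul_zero]
          · rw [pderiv_eq_zero_of_notMem_vars, map_zero, zero_mul]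
            intro hv
            rcases hp k hk hv with h | h
            · exact hik h
            · exact hi h
        · simp
    have := LinearMap.finrank_le_finrank_of_injective hf
    rw [Module.finrank_fintype_fun_eq_card, Fintype.card_coe] at this
    exact this.trans hcard


theorem pcdPr_smul {n : ℕ} (μ : Fin n → ℕ) (c u v : Fin n → ℂ) :
    pcdPr μ (fun i => c i * u i) (fun i => c i * v i) = Polynomial.C (∏ i, c i ^ μ i) * pcdPr μ u v := by
  unfold pcdPr
  rw [map_prod, ← Finset.prod_mul_distrib]
  refine Finset.prod_congr rfl fun i _ => ?_
  rw [Polynomial.C_pow, ← mul_pow]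
  congr 1
  simp only [pcdLin, Polynomial.C_mul]; ring

/-- universal parametrisation -/
def pcdY (r n : ℕ) (lam : Fin n → ℕ) (k : Fin (r+1)) : MvPolynomial (Option (Fin n)) ℂ :=
  (Polynomial.C (X none : MvPolynomial (Option (Fin n)) ℂ) *
    ∏ i, (Polynomial.C (X (some i)) + Polynomial.X) ^ lam i).coeff (k : ℕ)

theorem pcdY_eval (r n : ℕ) (lam : Fin n → ℕ) (w : Option (Fin n) → ℂ) :
    (fun k => eval w (pcdY r n lam k)) =
      pcdCf r (Polynomial.C (w none) * pcdPr lam (fun i => w (some i)) (fun _ => 1)) := by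
  ext k
  rw [pcdCf_apply, pcdY, ← Polynomial.coeff_map]
  congr 1
  simp [pcdPr, pcdLin, Polynomial.map_prod]

theorem pcd_eval_aeval' {σ τ : Type} (y : σ → MvPolynomial τ ℂ) (p : MvPolynomial σ ℂ) (w : τ → ℂ) :
    eval w (aeval y p) = eval (fun i => eval w (y i)) p := by
  change ((eval w).comp (eval₂Hom (algebraMap ℂ (MvPolynomial τ ℂ)) y)) p = _
  have : (eval w).comp (eval₂Hom (algebraMap ℂ (MvPolynomial τ ℂ)) y) = eval (fun i => eval w (y i)) := by
    ext <;> simp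
  rw [this]

theorem pcd_crl_cf (r n : ℕ) (lam : Fin n → ℕ) (hr : ∑ i, lam i = r) (x : Fin (r+1) → ℂ)
    (hx : x ∈ crlCone r n lam) : ∃ t u v, x = pcdCf r (Polynomial.C t * pcdPr lam u v) := by
  obtain ⟨t, u, v, h⟩ := (pcd_crl_iff r n lam hr x).mp hx
  exact ⟨t, u, v, by rw [← pcdCf_pol r x, h]; rfl⟩

theorem pcdLine_cf {n : ℕ} (r : ℕ) (lam : Fin n → ℕ) (t : ℂ) (u₀ v₀ u₁ v₁ : Fin n → ℂ) (s : ℂ) :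
    (fun k : Fin (r+1) => (Polynomial.C t * (pcdLine lam u₀ v₀ u₁ v₁).coeff (k : ℕ)).eval s) =
      pcdCf r (Polynomial.C t * pcdPr lam (pcdPt u₀ u₁ s) (pcdPt v₀ v₁ s)) := by
  ext k
  rw [pcdCf_apply, ← pcdLine_eval, Polynomial.coeff_C_mul, Polynomial.coeff_map]
  simp

theorem pcd_Pt_fin {n : ℕ} (v₀ v₁ : Fin n → ℂ) (h : ∀ i, v₁ i ≠ 0) :
    {s : ℂ | ∃ i, pcdPt v₀ v₁ s i = 0}.Finite := by
  have : {s : ℂ | ∃ i, pcdPt v₀ v₁ s i = 0} = ⋃ i, {s | pcdPt v₀ v₁ s i = 0} := by ext; simp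
  rw [this]
  refine Set.finite_iUnion fun i => ?_
  have h1 := pcd_poly_fin (Polynomial.C (v₀ i) + Polynomial.X * Polynomial.C (v₁ i - v₀ i)) 1 (by simpa using h i)
  refine h1.subset fun s hs => ?_
  simpa [pcdPt] using hs

theorem pcdY_vanish (r n : ℕ) (lam : Fin n → ℕ) (hr : ∑ i, lam i = r) (p : MvPolynomial (Fin (r+1)) ℂ)
    (hp : aeval (pcdY r n lam) p = 0) (x) (hx : x ∈ crlCone r n lam) : eval x p = 0 := by
  obtain ⟨t, u, v, rfl⟩ := pcd_crl_cf r n lam hr x hx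
  have key : ∀ u v : Fin n → ℂ, (∀ i, v i ≠ 0) → eval (pcdCf r (Polynomial.C t * pcdPr lam u v)) p = 0 := by
    intro u v hv
    have h1 := pcdPr_smul lam v (fun i => u i / v i) (fun _ => 1)
    have h2 : (fun i => v i * (u i / v i)) = u := by ext i; field_simp [hv i]
    simp only [mul_one] at h1
    rw [h2] at h1
    have h3 := congrArg (eval (fun o : Option (Fin n) => o.elim (t * ∏ i, v i ^ lam i) (fun i => u i / v i))) hp
    rw [pcd_eval_aeval', pcdY_eval, map_zero] at h3
    rw [h1, ← mul_assoc, ← Polynomial.C_mul]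
    exact h3
  have hc := pcd_curve_closure (fun k : Fin (r+1) => Polynomial.C t * (pcdLine lam u v u (fun _ => 1)).coeff (k : ℕ))
    {x | eval x p = 0} _ (pcd_Pt_fin v (fun _ => 1) (fun _ => one_ne_zero)) (by
      intro s hs
      rw [pcdLine_cf]
      refine key _ _ fun i h => hs ⟨i, h⟩) 0
  rw [pcdLine_cf] at hc
  have p0 : ∀ x y : Fin n → ℂ, pcdPt x y 0 = x := by intro x y; ext i; simp [pcdPt]
  rw [p0, p0] at hc
  exact hc p fun y hy => hy

theorem pcd_smooth (r n : ℕ) (lam : Fin n → ℕ) (hlam : ∀ i, 1 ≤ lam i) (hr : ∑ i, lam i = r) (hn : 1 ≤ n) :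
    ∃ (D : MvPolynomial (Fin (r+1)) ℂ) (u v : Fin n → ℂ), (∀ i, v i ≠ 0) ∧
      eval (pcdCf r (pcdPr lam u v)) D ≠ 0 ∧
      ∀ x, eval x D ≠ 0 → zTangentDim (crlCone r n lam) x ≤ n + 1 := by
  obtain ⟨D, hD, hT⟩ := pcd_generic_tangent (pcdY r n lam) (crlCone r n lam) (pcdY_vanish r n lam hr)
  have hne : aeval (pcdY r n lam) D * X none ≠ 0 := mul_ne_zero hD (X_ne_zero _)
  obtain ⟨w, hw⟩ : ∃ w, eval w (aeval (pcdY r n lam) D * X none) ≠ 0 := by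
    by_contra! h
    exact hne (MvPolynomial.funext fun w => by rw [h w, map_zero])
  rw [map_mul, eval_X, pcd_eval_aeval', pcdY_eval] at hw
  have h1 := left_ne_zero_of_mul hw
  have h2 := right_ne_zero_of_mul hw
  let i₀ : Fin n := ⟨0, hn⟩
  obtain ⟨z, hz⟩ := IsAlgClosed.exists_pow_nat_eq (w none) (hlam i₀)
  have hz0 : z ≠ 0 := by
    rintro rfl
    rw [zero_pow (by have := hlam i₀; omega)] at hz
    exact h2 hz.symm
  let c : Fin n → ℂ := fun i => if i = i₀ then z else 1
  have hc : ∀ i, c i ≠ 0 := by intro i; simp only [c]; split_ifs <;> simp [hz0]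
  have hprod : ∏ i, c i ^ lam i = w none := by
    rw [← hz, Finset.prod_eq_single i₀]
    · simp [c]
    · intro b _ hb; simp [c, hb]
    · simp
  refine ⟨D, fun i => c i * w (some i), fun i => c i * 1, fun i => by simpa using hc i, ?_, ?_⟩
  · rw [pcdPr_smul, hprod]; exact h1
  · intro x hx
    simpa using hT x hx

theorem pcd_tdim_ge (r n : ℕ) (lam : Fin n → ℕ) (hlam : ∀ i, 1 ≤ lam i) (hr : ∑ i, lam i = r)
    (t : ℂ) (ht : t ≠ 0) (u v : Fin n → ℂ) (h : ∀ i, ¬ (u i = 0 ∧ v i = 0)) :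
    n + 1 ≤ zTangentDim (crlCone r n lam) (pcdCf r (Polynomial.C t * pcdPr lam u v)) := by
  unfold zTangentDim
  rw [pcdT_span]
  have hg := pcdPr_ne (fun k => lam k - 1) u v h
  let f : (Fin (n+1) → ℂ) → pcdT (crlCone r n lam) (pcdCf r (Polynomial.C t * pcdPr lam u v)) :=
    fun b => ⟨pcdCf r (pcdPr (fun k => lam k - 1) u v * pcdPol n b), pcd_T1 r n lam hlam hr t ht u v _ (by
      exact lt_of_le_of_lt (Polynomial.degree_le_of_natDegree_le (pcdPol_natDegree n b)) (by exact_mod_cast Nat.lt_succ_self n))⟩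
  have hadd : ∀ b b', pcdPol n (b + b') = pcdPol n b + pcdPol n b' := by
    intro b b'; simp [pcdPol, add_mul, Finset.sum_add_distrib]
  have hsm : ∀ (z : ℂ) b, pcdPol n (z • b) = z • pcdPol n b := by
    intro z b
    simp [pcdPol, Finset.smul_sum, Polynomial.smul_eq_C_mul, mul_assoc]
  let F : (Fin (n+1) → ℂ) →ₗ[ℂ] pcdT (crlCone r n lam) (pcdCf r (Polynomial.C t * pcdPr lam u v)) :=
    { toFun := f
      map_add' := fun b b' => Subtype.ext (by simp only [f]; rw [hadd, mul_add, map_add]; rfl)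
      map_smul' := fun z b => Subtype.ext (by simp only [f]; rw [hsm, mul_smul_comm, map_smul]; rfl) }
  have hF : Function.Injective F := by
    rw [← LinearMap.ker_eq_bot, LinearMap.ker_eq_bot']
    intro b hb
    have h1 : pcdCf r (pcdPr (fun k => lam k - 1) u v * pcdPol n b) = 0 := congrArg Subtype.val hb
    have hdeg : (pcdPr (fun k => lam k - 1) u v * pcdPol n b).natDegree ≤ r := by
      refine Polynomial.natDegree_mul_le.trans ?_
      have h2 := pcdPr_natDegree (fun k => lam k - 1) u v
      have h3 := pcdPol_natDegree n b
      have h4 : ∑ i, (lam i - 1) + n = r := by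
        rw [← hr]
        have : ∑ i, lam i = ∑ i, ((lam i - 1) + 1) := Finset.sum_congr rfl fun i _ => by have := hlam i; omega
        rw [this, Finset.sum_add_distrib]; simp
      omega
    have h5 := pcdPol_cf r _ hdeg
    rw [h1] at h5
    have h6 : pcdPr (fun k => lam k - 1) u v * pcdPol n b = 0 := by rw [← h5]; simp [pcdPol]
    have h7 := (mul_eq_zero.mp h6).resolve_left hg
    by_contra hb0
    exact pcdPol_ne_zero.mpr hb0 h7
  have := LinearMap.finrank_le_finrank_of_injective hF
  simpa using this


/-- incidence condition -/
def pcdInc (k r n N' : ℕ) (μ ν : Fin n → ℕ) (N : Fin k → Fin (r+1) → ℂ) (u v : Fin n → ℂ) (φ : Fin (r+1) → ℂ) : Prop :=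
  (∃ c : Option (Fin k) → ℂ, c ≠ 0 ∧ ∀ b : Fin (r+1),
    c none * pcdCf r (pcdPr μ u v) b + ∑ i, c (some i) * N i b = 0) ∧
  (∀ a, ∑ i, φ i * N a i = 0) ∧
  ∀ b : Fin N', ∑ i, φ i * pcdCf r (pcdPr ν u v * Polynomial.X ^ (b : ℕ)) i = 0

theorem pcdInc_scale {k r n N' : ℕ} {μ ν : Fin n → ℕ} {N : Fin k → Fin (r+1) → ℂ} {u v : Fin n → ℂ} {φ : Fin (r+1) → ℂ}
    (h : pcdInc k r n N' μ ν N u v φ) (e : Fin n → ℂ) (f : ℂ) :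
    pcdInc k r n N' μ ν N (fun i => e i * u i) (fun i => e i * v i) (fun i => f * φ i) := by
  obtain ⟨⟨c, hc, h1⟩, h2, h3⟩ := h
  refine ⟨?_, ?_, ?_⟩
  · rw [pcdPr_smul, ← Polynomial.smul_eq_C_mul, map_smul]
    by_cases hτ : ∏ i, e i ^ μ i = 0
    · refine ⟨fun o => o.elim 1 (fun _ => 0), fun h => ?_, ?_⟩
      · have := congrFun h none
        simp at this
      · intro b; simp [hτ]
    · refine ⟨fun o => o.elim (c none) (fun i => (∏ i, e i ^ μ i) * c (some i)), fun h => hc ?_, ?_⟩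
      · ext o
        have h4 := congrFun h o
        cases o with
        | none => exact h4
        | some i => exact (mul_eq_zero.mp h4).resolve_left hτ
      · intro b
        have := congrArg (fun z => (∏ i, e i ^ μ i) * z) (h1 b)
        simp only [mul_add, mul_zero, Finset.mul_sum] at this
        rw [← this]
        simp only [Option.elim, Pi.smul_apply, smul_eq_mul, mul_assoc]
        congr 1
        ring
  · intro a
    rw [← mul_zero f, ← h2 a, Finset.mul_sum]
    exact Finset.sum_congr rfl fun i _ => by ring
  · intro b
    rw [pcdPr_smul, mul_assoc, ← Polynomial.smul_eq_C_mul, map_smul]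
    rw [← mul_zero (f * ∏ i, e i ^ ν i), ← h3 b, Finset.mul_sum]
    exact Finset.sum_congr rfl fun i _ => by simp only [Pi.smul_apply, smul_eq_mul]; ring

/-- variable index type -/
abbrev pcdIx (k r n : ℕ) : Type := (Fin k × Fin (r+1)) ⊕ ((Fin n × Fin 2) ⊕ Fin (r+1))

/-- the incidence set -/
def pcdZ (k r n N' : ℕ) (μ ν : Fin n → ℕ) : Set (pcdIx k r n → ℂ) :=
  {w | pcdInc k r n N' μ ν (fun a b => w (Sum.inl (a, b))) (fun i => w (Sum.inr (Sum.inl (i, 0))))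
    (fun i => w (Sum.inr (Sum.inl (i, 1)))) (fun b => w (Sum.inr (Sum.inr b)))}

/-- generic product -/
def pcdG (k r n : ℕ) (μ : Fin n → ℕ) : Polynomial (MvPolynomial (pcdIx k r n) ℂ) :=
  ∏ i, (Polynomial.C (X (Sum.inr (Sum.inl (i, 0)))) + Polynomial.C (X (Sum.inr (Sum.inl (i, 1)))) * Polynomial.X) ^ μ i

theorem pcdG_map (k r n : ℕ) (μ : Fin n → ℕ) (w : pcdIx k r n → ℂ) :
    (pcdG k r n μ).map (eval w) = pcdPr μ (fun i => w (Sum.inr (Sum.inl (i, 0)))) (fun i => w (Sum.inr (Sum.inl (i, 1)))) := by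
  simp [pcdG, pcdPr, pcdLin, Polynomial.map_prod]

theorem pcdZ_closed (k r n N' : ℕ) (μ ν : Fin n → ℕ) : pcdZC (pcdZ k r n N' μ ν) := by
  have h1 := pcd_elim_dep (ρ := pcdIx k r n) (κ := Option (Fin k)) (β := Fin (r+1))
    (fun o b => o.elim ((pcdG k r n μ).coeff (b : ℕ)) (fun a => X (Sum.inl (a, b))))
  have h2 := pcdZC_eqs (ρ := pcdIx k r n) (I := Fin k)
    (fun a => ∑ i : Fin (r+1), X (Sum.inr (Sum.inr i)) * X (Sum.inl (a, i)))
  have h3 := pcdZC_eqs (ρ := pcdIx k r n) (I := Fin N')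
    (fun b => ∑ i : Fin (r+1), X (Sum.inr (Sum.inr i)) * (pcdG k r n ν * Polynomial.X ^ (b : ℕ)).coeff (i : ℕ))
  have h := pcdZC_inter h1 (pcdZC_inter h2 h3)
  convert h using 1
  ext w
  simp only [pcdZ, pcdInc, Set.mem_ofPred_eq, Set.mem_inter_iff]
  refine and_congr ?_ (and_congr ?_ ?_)
  · refine exists_congr fun c => and_congr_right fun _ => forall_congr' fun b => ?_
    rw [Fintype.sum_option]
    simp only [Option.elim, eval_X]
    rw [← Polynomial.coeff_map, pcdG_map, pcdCf_apply]
  · refine forall_congr' fun a => ?_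
    simp
  · refine forall_congr' fun b => ?_
    rw [map_sum]
    refine Eq.congr (Finset.sum_congr rfl fun i _ => ?_) rfl
    rw [(eval w).map_mul, eval_X, ← Polynomial.coeff_map, Polynomial.map_mul, pcdG_map, pcdCf_apply]
    simp

/-- coordinate blocks -/
def pcdBl (k r n : ℕ) (o : Option (Fin n)) : Set (pcdIx k r n) :=
  {x | match x with
    | Sum.inl _ => False
    | Sum.inr (Sum.inl p) => o = some p.1
    | Sum.inr (Sum.inr _) => o = none}

/-- base set of the projection -/
def pcdBase (k r n N' : ℕ) (μ ν : Fin n → ℕ) : Set (Fin k × Fin (r+1) → ℂ) :=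
  {N | ∃ u v φ, (∀ i, ¬ (u i = 0 ∧ v i = 0)) ∧ φ ≠ 0 ∧ pcdInc k r n N' μ ν (fun a b => N (a, b)) u v φ}

theorem pcdBase_closed (k r n N' : ℕ) (μ ν : Fin n → ℕ) : pcdZC (pcdBase k r n N' μ ν) := by
  classical
  have h := pcd_elim_multi (pcdBl k r n) (by
      intro i j hij x hx hx'
      rcases x with x | x | x
      · exact hx
      · exact hij ((show i = some x.1 from hx).trans (show j = some x.1 from hx').symm)
      · exact hij ((show i = none from hx).trans (show j = none from hx').symm))
    (pcdZ k r n N' μ ν) (pcdZ_closed k r n N' μ ν) (by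
      intro o w hw c w' h1 h2
      have hs := pcdInc_scale hw (fun i => if o = some i then c else 1) (if o = none then c else 1)
      have e0 : (fun (a : Fin k) (b : Fin (r+1)) => w' (Sum.inl (a, b))) = fun a b => w (Sum.inl (a, b)) := by
        ext a b; exact h1 _ (fun h => h)
      have e1 : ∀ z : Fin 2, (fun i => w' (Sum.inr (Sum.inl (i, z)))) = fun i => (if o = some i then c else 1) * w (Sum.inr (Sum.inl (i, z))) := by
        intro z
        ext i
        split_ifs with ho
        · exact h2 _ ho
        · rw [one_mul]; exact h1 _ ho
      have e2 : (fun i => w' (Sum.inr (Sum.inr i))) = fun i => (if o = none then c else 1) * w (Sum.inr (Sum.inr i)) := by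
        ext i
        split_ifs with ho
        · exact h2 _ ho
        · rw [one_mul]; exact h1 _ ho
      show pcdInc _ _ _ _ _ _ _ _ _ _
      rw [e0, e1, e1, e2]
      exact hs) Finset.univ
  intro N hN
  let ext' : (Fin k × Fin (r+1) → ℂ) → pcdIx k r n → ℂ := fun N => Sum.elim N (fun _ => 0)
  have hiff : ∀ N, N ∈ pcdBase k r n N' μ ν ↔ ext' N ∈ {w | ∃ w' ∈ pcdZ k r n N' μ ν,
      (∀ x, (∀ i ∈ (Finset.univ : Finset (Option (Fin n))), x ∉ pcdBl k r n i) → w' x = w x) ∧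
        ∀ i ∈ (Finset.univ : Finset (Option (Fin n))), ∃ x ∈ pcdBl k r n i, w' x ≠ 0} := by
    intro N
    constructor
    · rintro ⟨u, v, φ, huv, hφ, hi⟩
      refine ⟨Sum.elim N (Sum.elim (fun p => if p.2 = 0 then u p.1 else v p.1) φ), hi, ?_, ?_⟩
      · rintro (x | x | x) hx
        · rfl
        · exact absurd rfl (hx (some x.1) (Finset.mem_univ _))
        · exact absurd rfl (hx none (Finset.mem_univ _))
      · rintro (_ | i) -
        · obtain ⟨b, hb⟩ := Function.ne_iff.mp hφ
          exact ⟨Sum.inr (Sum.inr b), rfl, hb⟩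
        · by_cases hu : u i = 0
          · refine ⟨Sum.inr (Sum.inl (i, 1)), rfl, ?_⟩
            have : v i ≠ 0 := fun hv => huv i ⟨hu, hv⟩
            simpa using this
          · refine ⟨Sum.inr (Sum.inl (i, 0)), rfl, ?_⟩
            simpa using hu
    · rintro ⟨w', hw', h1, h2⟩
      refine ⟨fun i => w' (Sum.inr (Sum.inl (i, 0))), fun i => w' (Sum.inr (Sum.inl (i, 1))), fun b => w' (Sum.inr (Sum.inr b)), ?_, ?_, ?_⟩
      · rintro i ⟨ha, hb⟩
        obtain ⟨x, hx, hne⟩ := h2 (some i) (Finset.mem_univ _)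
        rcases x with x | x | x
        · exact hx
        · obtain ⟨i', z⟩ := x
          have : i = i' := Option.some.inj hx
          subst this
          fin_cases z
          · exact hne ha
          · exact hne hb
        · exact absurd (show some i = none from hx) (by simp)
      · intro h0
        obtain ⟨x, hx, hne⟩ := h2 none (Finset.mem_univ _)
        rcases x with x | x | x
        · exact hx
        · exact absurd (show none = some x.1 from hx) (by simp)
        · exact hne (congrFun h0 x)
      · have e0 : (fun (a : Fin k) (b : Fin (r+1)) => N (a, b)) = fun a b => w' (Sum.inl (a, b)) := by
          ext a b; exact (h1 (Sum.inl (a, b)) (fun i _ h => h)).symm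
        rw [e0]
        exact hw'
  rw [hiff]
  refine h _ fun p hp => ?_
  have hev : ∀ N : Fin k × Fin (r+1) → ℂ, eval N (aeval (Sum.elim X (fun _ => 0) : pcdIx k r n → MvPolynomial (Fin k × Fin (r+1)) ℂ) p) = eval (ext' N) p := by
    intro N
    rw [pcd_eval_aeval']
    congr 2
    ext x
    rcases x with x | x <;> simp [ext']
  rw [← hev]
  refine hN _ fun z hz => ?_
  rw [hev]
  exact hp _ ((hiff z).mp hz)

/-- geometric incidence -/
def pcdGeo (r n N' : ℕ) (μ ν : Fin n → ℕ) (H : Submodule ℂ (Fin (r+1) → ℂ)) : Prop :=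
  ∃ (u v : Fin n → ℂ) (φ : Fin (r+1) → ℂ), (∀ i, ¬ (u i = 0 ∧ v i = 0)) ∧ φ ≠ 0 ∧
    pcdCf r (pcdPr μ u v) ∈ H ∧ (∀ b ∈ H, ∑ i, φ i * b i = 0) ∧
    ∀ b : Fin N', ∑ i, φ i * pcdCf r (pcdPr ν u v * Polynomial.X ^ (b : ℕ)) i = 0

theorem pcd_closed_app (k r n N' : ℕ) (μ ν : Fin n → ℕ) (T : Set ((Fin k → Fin (r+1)) → ℂ))
    (hT : ∀ U ∈ T, ∃ M : Matrix (Fin k) (Fin (r+1)) ℂ, U = plucker M ∧ pcdGeo r n N' μ ν (rowSpan M))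
    (M₀ : Matrix (Fin k) (Fin (r+1)) ℂ) (hM₀ : Module.finrank ℂ (rowSpan M₀) = k)
    (h : plucker M₀ ∈ zClosure T) : pcdGeo r n N' μ ν (rowSpan M₀) := by
  obtain ⟨N, hN, u, v, φ, huv, hφ, ⟨c, hc, h1⟩, h2, h3⟩ :=
    pcd_closed T (pcdBase k r n N' μ ν) (pcdBase_closed k r n N' μ ν) (by
      intro U hU
      obtain ⟨M, hUM, u, v, φ, huv, hφ, hx, hH, hg⟩ := hT U hU
      refine ⟨M, hUM, fun N hN => ⟨u, v, φ, huv, hφ, ?_, ?_, hg⟩⟩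
      · rw [← hN] at hx
        obtain ⟨c, hc⟩ := (Submodule.mem_span_range_iff_exists_fun ℂ).mp hx
        refine ⟨fun o => o.elim (-1) c, fun h => ?_, fun b => ?_⟩
        · have := congrFun h none
          simp at this
        · rw [← hc]
          simp
      · intro a
        refine hH _ ?_
        rw [← hN]
        exact Submodule.subset_span ⟨a, rfl⟩) M₀ hM₀ h
  rw [← hN] at hM₀ ⊢
  have hli : LinearIndependent ℂ (fun i => N i) := by
    rw [linearIndependent_iff_card_eq_finrank_span]
    rw [Fintype.card_fin]; exact hM₀.symm
  refine ⟨u, v, φ, huv, hφ, ?_, ?_, h3⟩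
  · have hc0 : c none ≠ 0 := by
      intro h0
      apply hc
      have h4 : ∑ i, c (some i) • N i = 0 := by
        ext b
        have := h1 b
        rw [h0, zero_mul, zero_add] at this
        simpa using this
      have h5 := Fintype.linearIndependent_iff.mp hli _ h4
      ext o
      cases o with
      | none => exact h0
      | some i => exact h5 i
    have h4 : c none • pcdCf r (pcdPr μ u v) = -∑ i, c (some i) • N i := by
      ext b
      have := h1 b
      rw [eq_comm, ← sub_eq_zero]
      simp only [Pi.smul_apply, Pi.neg_apply, Finset.sum_apply, smul_eq_mul]
      linear_combination -this
    rw [← Submodule.smul_mem_iff _ hc0, h4]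
    exact Submodule.neg_mem _ (Submodule.sum_mem _ fun i _ => Submodule.smul_mem _ _ (Submodule.subset_span ⟨i, rfl⟩))
  · intro b hb
    obtain ⟨c, rfl⟩ := (Submodule.mem_span_range_iff_exists_fun ℂ).mp hb
    simp only [Finset.sum_apply, Pi.smul_apply, smul_eq_mul, Finset.mul_sum]
    rw [Finset.sum_comm]
    refine Finset.sum_eq_zero fun a _ => ?_
    rw [← mul_zero (c a), ← h2 a, Finset.mul_sum]
    exact Finset.sum_congr rfl fun i _ => by ring


theorem pcd_exists_phi {m : ℕ} (W : Submodule ℂ (Fin m → ℂ)) (h : Module.finrank ℂ W < m) :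
    ∃ φ : Fin m → ℂ, φ ≠ 0 ∧ ∀ b ∈ W, ∑ i, φ i * b i = 0 := by
  have hW : W < ⊤ := by
    rw [lt_top_iff_ne_top]
    rintro rfl
    rw [finrank_top] at h
    simp at h
  obtain ⟨f, hf, hk⟩ := Submodule.exists_le_ker_of_lt_top W hW
  have hs : ∀ b, f b = ∑ i, f (Pi.single i 1) * b i := by
    intro b
    rw [LinearMap.pi_apply_eq_sum_univ f b]
    refine Finset.sum_congr rfl fun i _ => ?_
    rw [smul_eq_mul, mul_comm]
    congr 2
    ext k
    simp [Pi.single_apply, eq_comm]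
  refine ⟨fun i => f (Pi.single i 1), fun h0 => hf ?_, fun b hb => ?_⟩
  · ext1 b
    have h1 : f (Pi.single b 1) = 0 := congrFun h0 b
    ext
    simpa using h1
  · rw [← hs]; exact hk hb

theorem pcd_deg_iff (p : Polynomial ℂ) (n : ℕ) : p.natDegree ≤ n ↔ p.degree < ((n + 1 : ℕ) : WithBot ℕ) := by
  rw [Polynomial.natDegree_le_iff_coeff_eq_zero, Polynomial.degree_lt_iff_coeff_zero]
  rfl

theorem pcd_CH_geo (r n k j : ℕ) (lam : Fin n → ℕ) (hlam : ∀ i, 1 ≤ lam i) (hr : ∑ i, lam i = r)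
    (hk : k + n ≤ r + j) (U) (hU : U ∈ smoothCHCone r (crlCone r n lam) (n+1) k j) :
    ∃ M : Matrix (Fin k) (Fin (r+1)) ℂ, U = plucker M ∧
      pcdGeo r n (n+1) lam (fun i => lam i - 1) (rowSpan M) := by
  obtain ⟨M, rfl, hM, x, hx0, hxS, hdim, hxM, hfr⟩ := hU
  refine ⟨M, rfl, ?_⟩
  obtain ⟨t, u, v, rfl⟩ := pcd_crl_cf r n lam hr x hxS
  have hP : Polynomial.C t * pcdPr lam u v ≠ 0 := by
    intro h; rw [h, map_zero] at hx0; exact hx0 rfl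
  have ht : t ≠ 0 := by rintro rfl; simp at hP
  have hP' : pcdPr lam u v ≠ 0 := right_ne_zero_of_mul hP
  unfold zTangentDim at hdim
  rw [pcdT_span] at hdim hfr
  have hsum := Submodule.finrank_sup_add_finrank_inf_eq (rowSpan M)
    (pcdT (crlCone r n lam) (pcdCf r (Polynomial.C t * pcdPr lam u v)))
  obtain ⟨φ, hφ, hφ0⟩ := pcd_exists_phi (rowSpan M ⊔
    (pcdT (crlCone r n lam) (pcdCf r (Polynomial.C t * pcdPr lam u v)))) (by omega)
  refine ⟨u, v, φ, ?_, hφ, ?_, ?_, ?_⟩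
  · rintro i ⟨h1, h2⟩
    refine hP' (Finset.prod_eq_zero (Finset.mem_univ i) ?_)
    rw [h1, h2]
    have := hlam i
    simp only [pcdLin, map_zero, zero_mul, add_zero]
    exact zero_pow (by omega)
  · rw [← Polynomial.smul_eq_C_mul, map_smul] at hxM
    exact (Submodule.smul_mem_iff _ ht).mp hxM
  · intro b hb
    exact hφ0 b (Submodule.mem_sup_left hb)
  · intro b
    refine hφ0 _ (Submodule.mem_sup_right (pcd_T1 r n lam hlam hr t ht u v _ ?_))
    rw [← pcd_deg_iff, Polynomial.natDegree_X_pow]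
    omega

theorem pcd_meet_geo (s n k : ℕ) (μ : Fin n → ℕ) (hs : ∑ i, μ i = s) (hk : k ≤ s) (U)
    (hU : U ∈ meetCone s (crlCone s n μ) k) :
    ∃ M : Matrix (Fin k) (Fin (s+1)) ℂ, U = plucker M ∧ pcdGeo s n 0 μ μ (rowSpan M) := by
  classical
  obtain ⟨M, rfl, hM, x, hx0, hxS, hxM⟩ := hU
  refine ⟨M, rfl, ?_⟩
  obtain ⟨t, u, v, rfl⟩ := pcd_crl_cf s n μ hs x hxS
  have hP : Polynomial.C t * pcdPr μ u v ≠ 0 := by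
    intro h; rw [h, map_zero] at hx0; exact hx0 rfl
  have ht : t ≠ 0 := by rintro rfl; simp at hP
  have hP' : pcdPr μ u v ≠ 0 := right_ne_zero_of_mul hP
  obtain ⟨φ, hφ, hφ0⟩ := pcd_exists_phi (rowSpan M) (by omega)
  let u' : Fin n → ℂ := fun i => if u i = 0 ∧ v i = 0 then 1 else u i
  have he : pcdPr μ u' v = pcdPr μ u v := by
    refine Finset.prod_congr rfl fun i _ => ?_
    by_cases h : u i = 0 ∧ v i = 0
    · have h0 : μ i = 0 := by
        by_contra hne
        refine hP' (Finset.prod_eq_zero (Finset.mem_univ i) ?_)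
        rw [h.1, h.2]
        simp only [pcdLin, map_zero, zero_mul, add_zero]
        exact zero_pow hne
      rw [h0, pow_zero, pow_zero]
    · simp only [u', if_neg h]
  refine ⟨u', v, φ, ?_, hφ, ?_, hφ0, fun b => b.elim0⟩
  · rintro i ⟨h1, h2⟩
    by_cases h : u i = 0 ∧ v i = 0
    · simp [u', h] at h1
    · simp only [u', if_neg h] at h1
      exact h ⟨h1, h2⟩
  · rw [he]
    rw [← Polynomial.smul_eq_C_mul, map_smul] at hxM
    exact (Submodule.smul_mem_iff _ ht).mp hxM

theorem pcd_finrank_ge (r j : ℕ) (P : Polynomial ℂ) (hP : P ≠ 0) (hd : P.natDegree + j ≤ r)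
    (W : Submodule ℂ (Fin (r+1) → ℂ)) (h : ∀ b, pcdCf r (P * pcdPol j b) ∈ W) :
    j + 1 ≤ Module.finrank ℂ W := by
  have hadd : ∀ b b', pcdPol j (b + b') = pcdPol j b + pcdPol j b' := by
    intro b b'; simp [pcdPol, add_mul, Finset.sum_add_distrib]
  have hsm : ∀ (z : ℂ) b, pcdPol j (z • b) = z • pcdPol j b := by
    intro z b
    simp [pcdPol, Finset.smul_sum, Polynomial.smul_eq_C_mul, mul_assoc]
  let F : (Fin (j+1) → ℂ) →ₗ[ℂ] W :=
    { toFun := fun b => ⟨pcdCf r (P * pcdPol j b), h b⟩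
      map_add' := fun b b' => Subtype.ext (by simp only; rw [hadd, mul_add, map_add]; rfl)
      map_smul' := fun z b => Subtype.ext (by simp only; rw [hsm, mul_smul_comm, map_smul]; rfl) }
  have hF : Function.Injective F := by
    rw [← LinearMap.ker_eq_bot, LinearMap.ker_eq_bot']
    intro b hb
    have h1 : pcdCf r (P * pcdPol j b) = 0 := congrArg Subtype.val hb
    have hdeg : (P * pcdPol j b).natDegree ≤ r := by
      refine Polynomial.natDegree_mul_le.trans ?_
      have h3 := pcdPol_natDegree j b
      omega
    have h5 := pcdPol_cf r _ hdeg
    rw [h1] at h5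
    have h6 : P * pcdPol j b = 0 := by rw [← h5]; simp [pcdPol]
    have h7 := (mul_eq_zero.mp h6).resolve_left hP
    by_contra hb0
    exact pcdPol_ne_zero.mpr hb0 h7
  have := LinearMap.finrank_le_finrank_of_injective hF
  simpa using this

theorem pcdL_smul (d : ℕ) (κ : ℂ) (a : Fin (d+1) → ℂ) (p : Polynomial ℂ) : pcdL d (κ • a) p = κ * pcdL d a p := by
  rw [pcdL_apply, pcdL_apply, Finset.mul_sum]
  exact Finset.sum_congr rfl fun i _ => by simp only [Pi.smul_apply, smul_eq_mul]; ring

theorem pcdL_single (d n : ℕ) (hn : n < d + 1) (p : Polynomial ℂ) :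
    pcdL d (Pi.single ⟨n, hn⟩ 1) p = pcdW d n * p.coeff n := by
  rw [pcdL_apply, Finset.sum_eq_single ⟨n, hn⟩]
  · simp
  · intro i _ hi; simp [hi]
  · simp

theorem pcd_D1 (s n d : ℕ) (hd : d = s + n) (hns : n + 1 ≤ s) (μ : Fin n → ℕ) (hs : ∑ i, μ i = s)
    (u v : Fin n → ℂ) (huv : ∀ i, ¬ (u i = 0 ∧ v i = 0)) (a : Fin (d+1) → ℂ)
    (ha : pcdCf s (pcdPr μ u v) ∈ apolarSet d s a) :
    a ∈ zClosure (apolarPull d s (s - n) (zClosure (meetCone s (crlCone s n μ) (s - n)))) := by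
  have h1 : pcdPr μ (fun _ => 1) (fun _ => 0) = 1 := by simp [pcdPr, pcdLin]
  have hn1 : n + 1 < d + 1 := by omega
  obtain ⟨c, hc0, ⟨κ, hκ, hc1⟩, hct⟩ := pcd_curve μ s n d hs hd u v (fun _ => 1) (fun _ => 0)
    (pcdPr_ne μ u v huv) (by rw [h1]; exact one_ne_zero) a (Pi.single ⟨n+1, hn1⟩ 1) ha (by
      rw [h1, pcd_apolar_iff s n d hd]
      intro Q hQ
      rw [pcdPol_cf s 1 (by simp), one_mul, pcdL_single, Polynomial.coeff_eq_zero_of_natDegree_lt (by omega), mul_zero])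
  have hgood : pcdGood d n (fun i => (c i).eval 1) := by
    rw [hc1]
    intro b hb
    rw [pcd_apolar_iff n s d (by omega)] at hb
    ext i
    have := hb (Polynomial.X ^ (n + 1 - (i : ℕ))) (by rw [Polynomial.natDegree_X_pow]; omega)
    rw [pcdL_smul, pcdL_single] at this
    have h2 := (mul_eq_zero.mp ((mul_eq_zero.mp this).resolve_left hκ)).resolve_left (pcdW_ne _ _)
    have hi := i.2
    have h3 : n + 1 = (i : ℕ) + (n + 1 - (i : ℕ)) := by omega
    have h4 : (pcdPol n b * Polynomial.X ^ (n + 1 - (i : ℕ))).coeff ((i : ℕ) + (n + 1 - (i : ℕ))) = 0 := by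
      rw [← h3]; exact h2
    rw [Polynomial.coeff_mul_X_pow, pcdPol_coeff] at h4
    exact h4
  have hF := (pcd_good_open s n d hd c 1 hgood).union (pcd_Pt_fin u (fun _ => 1) (fun _ => one_ne_zero))
  rw [← hc0]
  refine pcd_curve_closure c _ _ hF ?_ 0
  intro t ht
  have ht1 : pcdGood d n (fun i => (c i).eval t) := by
    by_contra h; exact ht (Or.inl h)
  have ht2 : ∀ i, pcdPt u (fun _ => 1) t i ≠ 0 := fun i h => ht (Or.inr ⟨i, h⟩)
  obtain ⟨M, hM1, hM2⟩ := pcd_good_rows s n d hd (by omega) _ ht1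
  refine ⟨M, hM1, hM2, pcd_subset_zClosure _ ⟨M, rfl, hM2, pcdCf s (Polynomial.C 1 * pcdPr μ (pcdPt u (fun _ => 1) t) (pcdPt v (fun _ => 0) t)), ?_, pcd_crl_mem s n μ hs _ _ _, ?_⟩⟩
  · rw [Polynomial.C_1, one_mul, ← pcdPol_ne_zero, pcdPol_cf]
    · exact pcdPr_ne _ _ _ fun i h => ht2 i h.1
    · rw [← hs]; exact pcdPr_natDegree _ _ _
  · rw [hM1, Polynomial.C_1, one_mul]
    exact Submodule.subset_span (hct t)

theorem pcd_sum_sub {n : ℕ} (lam ι : Fin n → ℕ) (hlam : ∀ i, 1 ≤ lam i) (hι : ∀ i, ι i ≤ 1) (r j : ℕ)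
    (hr : ∑ i, lam i = r) (hj : ∑ i, ι i = j) : ∑ i, (lam i - ι i) = r - j := by
  have : ∑ i, (lam i - ι i) + ∑ i, ι i = ∑ i, lam i := by
    rw [← Finset.sum_add_distrib]
    exact Finset.sum_congr rfl fun i _ => by have := hlam i; have := hι i; omega
  omega

theorem pcd_D2 (r n j d k : ℕ) (lam : Fin n → ℕ) (hlam : ∀ i, 1 ≤ lam i) (hr : ∑ i, lam i = r)
    (hjn : j ≤ n) (hjr : j + n + 1 ≤ r) (hd : d = r + n - j) (hk : k = r - n + j) (a : Fin (d+1) → ℂ)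
    (ha : a ∈ apolarPull d r k (zClosure (smoothCHCone r (crlCone r n lam) (n+1) k j))) :
    ∃ ι : Fin n → ℕ, ((∀ i, ι i ≤ 1) ∧ ∑ i, ι i = j) ∧
      a ∈ zClosure (apolarPull d (r - j) (r - j - n)
            (zClosure (meetCone (r - j) (crlCone (r - j) n fun i => lam i - ι i) (r - j - n)))) := by
  obtain ⟨M, hM1, hM2, hM3⟩ := ha
  obtain ⟨u, v, φ, huv, hφ, hx, hH, hg⟩ := pcd_closed_app k r n (n+1) lam (fun i => lam i - 1) _
    (pcd_CH_geo r n k j lam hlam hr (by omega)) M hM2 hM3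
  have hd' : d = r + (n - j) := by omega
  rw [hM1] at hx hH
  rw [pcd_mem_span_apolar r (n - j) d hd', pcd_apolar_iff r (n - j) d hd',
    pcdPol_cf r _ (by rw [← hr]; exact pcdPr_natDegree _ _ _)] at hx
  obtain ⟨q, hq, hqb⟩ := pcd_dual r (n - j) d hd' a φ fun b hb => hH b (Submodule.subset_span hb)
  have hq0 : q ≠ 0 := by
    rintro rfl
    apply hφ
    ext i
    have := hqb (Pi.single i 1)
    rw [mul_zero, map_zero, Finset.sum_eq_single i] at this
    · simpa using this
    · intro b _ hb; simp [hb]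
    · simp
  have hgdeg : ∀ b : ℕ, b ≤ n → (pcdPr (fun i => lam i - 1) u v * Polynomial.X ^ b).natDegree ≤ r := by
    intro b hb
    refine Polynomial.natDegree_mul_le.trans ?_
    have h2 := pcdPr_natDegree (fun k => lam k - 1) u v
    have h3 := pcd_sum_sub lam (fun _ => 1) hlam (fun _ => le_rfl) r n hr (by simp)
    rw [Polynomial.natDegree_X_pow]
    omega
  obtain ⟨ι, hι1, hιj, hι⟩ := pcd_iota n j hjn lam hlam u v huv q hq0 hq (pcdL d a) (by
    intro Q hQ
    have hQ' : Q = ∑ b : Fin (n+1), Polynomial.C (Q.coeff b) * Polynomial.X ^ (b : ℕ) :=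
      (pcdPol_cf n Q ((pcd_deg_iff Q n).mpr hQ)).symm
    rw [hQ', Finset.mul_sum, Finset.mul_sum, map_sum]
    refine Finset.sum_eq_zero fun b _ => ?_
    have h1 := hqb (pcdCf r (pcdPr (fun i => lam i - 1) u v * Polynomial.X ^ (b : ℕ)))
    rw [hg b, pcdPol_cf r _ (hgdeg b (by omega))] at h1
    have e : (∏ i, pcdLin (u i) (v i) ^ (lam i - 1)) * (q * (Polynomial.C (Q.coeff b) * Polynomial.X ^ (b : ℕ)))
        = Q.coeff b • (pcdPr (fun i => lam i - 1) u v * Polynomial.X ^ (b : ℕ) * q) := by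
      rw [Polynomial.smul_eq_C_mul]; unfold pcdPr; ring
    rw [e, map_smul, ← h1, smul_zero]) (by
    intro Q hQ
    exact hx Q ((pcd_deg_iff Q _).mpr hQ))
  have hs := pcd_sum_sub lam ι hlam hι1 r j hr hιj
  refine ⟨ι, ⟨hι1, hιj⟩, pcd_D1 (r - j) n d (by omega) (by omega) (fun i => lam i - ι i) hs u v huv a ?_⟩
  rw [pcd_apolar_iff (r - j) n d (by omega), pcdPol_cf (r - j) _ (by rw [← hs]; exact pcdPr_natDegree _ _ _)]
  intro Q hQ
  exact hι Q ((pcd_deg_iff Q n).mp hQ)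

theorem pcdPr_add {n : ℕ} (μ ν η : Fin n → ℕ) (h : ∀ i, μ i + ν i = η i) (u v : Fin n → ℂ) :
    pcdPr μ u v * pcdPr ν u v = pcdPr η u v := by
  unfold pcdPr
  rw [← Finset.prod_mul_distrib]
  exact Finset.prod_congr rfl fun i _ => by rw [← pow_add, h i]

theorem pcd_E (r n j d k : ℕ) (lam : Fin n → ℕ) (hlam : ∀ i, 1 ≤ lam i) (hr : ∑ i, lam i = r)
    (hjn : j ≤ n) (hjr : j + n + 1 ≤ r) (hd : d = r + n - j) (hk : k = r - n + j)
    (ι : Fin n → ℕ) (hι : ∀ i, ι i ≤ 1) (hιj : ∑ i, ι i = j) (a : Fin (d+1) → ℂ)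
    (ha : a ∈ apolarPull d (r - j) (r - j - n)
            (zClosure (meetCone (r - j) (crlCone (r - j) n fun i => lam i - ι i) (r - j - n)))) :
    a ∈ zClosure (apolarPull d r k (zClosure (smoothCHCone r (crlCone r n lam) (n+1) k j))) := by
  have hn : 1 ≤ n := by
    rcases Nat.eq_zero_or_pos n with h | h
    · subst h
      simp at hr
      omega
    · exact h
  have hs := pcd_sum_sub lam ι hlam hι r j hr hιj
  have hd1 : d = (r - j) + n := by omega
  have hd2 : d = r + (n - j) := by omega
  have hgood : pcdGood d n a := pcd_pull_good (r - j) n d hd1 (by omega) _ a ha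
  obtain ⟨M, hM1, hM2, hM3⟩ := ha
  obtain ⟨u, v, φ, huv, -, hx, -, -⟩ := pcd_closed_app (r - j - n) (r - j) n 0 _ _ _
    (pcd_meet_geo (r - j) n (r - j - n) (fun i => lam i - ι i) hs (by omega)) M hM2 hM3
  rw [hM1, pcd_mem_span_apolar (r - j) n d hd1] at hx
  obtain ⟨D, u₁, v₁, hv₁, hD, hT⟩ := pcd_smooth r n lam hlam hr hn
  obtain ⟨c, hc0, -, hct⟩ := pcd_curve (fun i => lam i - ι i) (r - j) n d hs hd1 u v u₁ v₁
    (pcdPr_ne _ u v huv) (pcdPr_ne _ u₁ v₁ fun i h => hv₁ i h.2) a 0 hx (by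
      rw [pcd_apolar_iff (r - j) n d hd1]
      intro Q _
      rw [pcdL_apply]; simp)
  have hF1 := pcd_good_open (r - j) n d hd1 c 0 (by rw [hc0]; exact hgood)
  have p1 : ∀ x y : Fin n → ℂ, pcdPt x y 1 = y := by intro x y; ext i; simp [pcdPt]
  have hev : ∀ t, (aeval (fun k : Fin (r+1) => Polynomial.C 1 * (pcdLine lam u v u₁ v₁).coeff (k : ℕ)) D).eval t
      = eval (pcdCf r (Polynomial.C 1 * pcdPr lam (pcdPt u u₁ t) (pcdPt v v₁ t))) D := by
    intro t
    rw [pcd_eval_aeval, pcdLine_cf]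
  have hF2 := pcd_poly_fin (aeval (fun k : Fin (r+1) => Polynomial.C 1 * (pcdLine lam u v u₁ v₁).coeff (k : ℕ)) D) 1
    (by rw [hev, p1, p1, Polynomial.C_1, one_mul]; exact hD)
  have hF3 := pcd_Pt_fin v v₁ hv₁
  rw [← hc0]
  refine pcd_curve_closure c _ _ ((hF1.union hF2).union hF3) ?_ 0
  intro t ht
  have ht1 : pcdGood d n (fun i => (c i).eval t) := by
    by_contra h; exact ht (Or.inl (Or.inl h))
  have ht2 : eval (pcdCf r (Polynomial.C 1 * pcdPr lam (pcdPt u u₁ t) (pcdPt v v₁ t))) D ≠ 0 := by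
    intro h; refine ht (Or.inl (Or.inr ?_)); rw [← hev] at h; exact h
  have ht3 : ∀ i, pcdPt v v₁ t i ≠ 0 := fun i h => ht (Or.inr ⟨i, h⟩)
  have hct' := hct t
  generalize pcdPt u u₁ t = U at *
  generalize pcdPt v v₁ t = V at *
  have hUV : ∀ i, ¬ (U i = 0 ∧ V i = 0) := fun i h => ht3 i h.2
  have hgood2 := pcd_good_mono d n (n - j) (by omega) (by omega) _ ht1
  have hrows := pcd_good_rows r (n - j) d hd2 (by omega) _ hgood2
  have hkk : r - (n - j) = k := by omega
  rw [hkk] at hrows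
  obtain ⟨M', hM1', hM2'⟩ := hrows
  have hx'deg : (pcdPr (fun i => lam i - ι i) U V).natDegree ≤ r - j := by
    rw [← hs]; exact pcdPr_natDegree _ _ _
  rw [pcd_apolar_iff (r - j) n d hd1, pcdPol_cf _ _ hx'deg] at hct'
  have hHmem : ∀ h : Polynomial ℂ, h.natDegree ≤ j → pcdCf r (pcdPr (fun i => lam i - ι i) U V * h) ∈ rowSpan M' := by
    intro h hh
    rw [hM1', pcd_mem_span_apolar r (n - j) d hd2, pcd_apolar_iff r (n - j) d hd2, pcdPol_cf]
    · intro Q hQ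
      rw [mul_assoc]
      refine hct' _ (Polynomial.natDegree_mul_le.trans (by omega))
    · exact Polynomial.natDegree_mul_le.trans (by omega)
  have hxe : pcdPr (fun i => lam i - ι i) U V * pcdPr ι U V = pcdPr lam U V :=
    pcdPr_add _ _ _ (fun i => by have := hlam i; have := hι i; omega) U V
  have hge : pcdPr (fun i => lam i - 1) U V * pcdPr (fun i => 1 - ι i) U V = pcdPr (fun i => lam i - ι i) U V :=
    pcdPr_add _ _ _ (fun i => by have := hlam i; have := hι i; omega) U V
  refine ⟨M', hM1', hM2', pcd_subset_zClosure _ ⟨M', rfl, hM2',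
    pcdCf r (Polynomial.C 1 * pcdPr lam U V), ?_, pcd_crl_mem r n lam hr _ _ _, ?_, ?_, ?_⟩⟩
  · rw [Polynomial.C_1, one_mul, ← pcdPol_ne_zero, pcdPol_cf]
    · exact pcdPr_ne _ _ _ hUV
    · rw [← hr]; exact pcdPr_natDegree _ _ _
  · exact le_antisymm (hT _ ht2) (pcd_tdim_ge r n lam hlam hr 1 one_ne_zero U V hUV)
  · rw [Polynomial.C_1, one_mul, ← hxe]
    exact hHmem _ (by rw [← hιj]; exact pcdPr_natDegree _ _ _)
  · rw [pcdT_span]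
    refine pcd_finrank_ge r j (pcdPr (fun i => lam i - ι i) U V) (pcdPr_ne _ _ _ hUV) (by omega) _ fun b => ⟨?_, ?_⟩
    · exact hHmem _ (pcdPol_natDegree j b)
    · rw [← hge, mul_assoc]
      refine pcd_T1 r n lam hlam hr 1 one_ne_zero U V _ ?_
      rw [← pcd_deg_iff]
      have h1 := pcdPr_natDegree (fun i => 1 - ι i) U V
      have h2 := pcd_sum_sub (fun _ => 1) ι (fun _ => le_rfl) hι n j (by simp) hιj
      have h3 := pcdPol_natDegree j b
      exact Polynomial.natDegree_mul_le.trans (by omega)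

theorem pcd_closure_union {σ I : Type} [Fintype σ] [DecidableEq σ] (A : Set (σ → ℂ)) (J : Set I) (hJ : J.Finite)
    (B : I → Set (σ → ℂ)) (h : ∀ a ∈ A, ∃ i ∈ J, a ∈ zClosure (B i)) (x) (hx : x ∈ zClosure A) :
    ∃ i ∈ J, x ∈ zClosure (B i) := by
  by_contra hcon
  have hne : ∀ i ∈ J, ∃ p : MvPolynomial σ ℂ, (∀ y ∈ B i, eval y p = 0) ∧ eval x p ≠ 0 := by
    intro i hi
    by_contra hc
    refine hcon ⟨i, hi, fun p hp => ?_⟩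
    by_contra h0
    exact hc ⟨p, hp, h0⟩
  choose! p hp hpx using hne
  have h0 := hx (∏ i ∈ hJ.toFinset, p i) (by
    intro a ha
    obtain ⟨i, hi, hai⟩ := h a ha
    rw [map_prod]
    exact Finset.prod_eq_zero (hJ.mem_toFinset.mpr hi) (hai (p i) (hp i hi)))
  rw [map_prod, Finset.prod_eq_zero_iff] at h0
  obtain ⟨i, hi, h1⟩ := h0
  exact hpx i (hJ.mem_toFinset.mp hi) h1


/-- Theorem: pullbacks of higher associated varieties: for a partition `λ` of
`r` of length `n`, `0 ≤ j ≤ min{n, r−n−1}` and `d = r+n−j`, set-theoretically the closure of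
`Ψ_{d,r}⁻¹(CH_j(Δ_λ))` equals the union, over the partitions `λ' = λ − ι ∈ D_j(λ)`, of the
closures of `Ψ_{d,r−j}⁻¹(Ξ_0^{r−j−n−1}(Δ_{λ'}))`. -/
theorem pullback_CH_decomposition (r n j : ℕ) (lam : Fin n → ℕ)
    (hpart : isPartitionOf r n lam) (hjn : j ≤ n) (hjr : j + n + 1 ≤ r) :
    zClosure (apolarPull (r + n - j) r (r - n + j)
        (zClosure (smoothCHCone r (crlCone r n lam) (n+1) (r - n + j) j)))
      = ⋃ ι ∈ {ι : Fin n → ℕ | (∀ i, ι i ≤ 1) ∧ ∑ i, ι i = j},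
          zClosure (apolarPull (r + n - j) (r - j) (r - j - n)
            (zClosure (meetCone (r - j)
              (crlCone (r - j) n fun i => lam i - ι i) (r - j - n)))) := by
  obtain ⟨hlam, hr⟩ := hpart
  ext x
  simp only [Set.mem_iUnion]
  constructor
  · intro hx
    have hfin : {ι : Fin n → ℕ | (∀ i, ι i ≤ 1) ∧ ∑ i, ι i = j}.Finite := by
      refine (Set.finite_Iic (fun _ : Fin n => 1)).subset fun ι hι => ?_
      exact fun i => hι.1 i
    obtain ⟨ι, hι, h⟩ := pcd_closure_union _ _ hfin
      (fun ι : Fin n → ℕ => apolarPull (r + n - j) (r - j) (r - j - n)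
            (zClosure (meetCone (r - j)
              (crlCone (r - j) n fun i => lam i - ι i) (r - j - n))))
      (fun a ha => pcd_D2 r n j _ _ lam hlam hr hjn hjr rfl rfl a ha) x hx
    exact ⟨ι, hι, h⟩
  · rintro ⟨ι, hι, h⟩
    exact pcd_zClosure_min (fun a ha =>
      pcd_E r n j _ _ lam hlam hr hjn hjr rfl rfl ι hι.1 hι.2 a ha) h
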